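/- arXiv:2102.12543 — 7 statements merged into one kernel-verified Lean document; each statement's English description precedes it below -/
import Mathlib

section
/- Maximum likelihood facets (Proposition, Appendix C.2): Let n' and d be integers with n' > d > 1. Then (I_{n'}, d), where I_{n'} is the n'×n' identity matrix, is a tight Bell inequality (facet) of the signaling polytope C_d^{n'→n'}; in particular every P ∈ C_d^{n'→n'} satisfies ∑_{y=1}^{n'} P(y|y) ≤ d, and there exist n'(n'−1) affinely independent vertices V of C_d^{n'→n'} with ∑_{y=1}^{n'} V(y|y) = d. -/
open Finset

/-- A classical channel: an `n' × n` column-stochastic real matrix. -/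
def IsChannel {n n' : ℕ} (P : Matrix (Fin n') (Fin n) ℝ) : Prop :=
  (∀ y x, 0 ≤ P y x) ∧ ∀ x, ∑ y, P y x = 1

/-- A vertex of the signaling polytope: a column-stochastic 0/1 matrix with
at most `d` nonzero rows. -/
def IsVertex {n n' : ℕ} (d : ℕ) (V : Matrix (Fin n') (Fin n) ℝ) : Prop :=
  IsChannel V ∧ (∀ y x, V y x = 0 ∨ V y x = 1) ∧
    ({y : Fin n' | ∃ x, V y x ≠ 0}).ncard ≤ d

/-- The signaling polytope `C_d^{n → n'}`. -/
def signalingPolytope (n n' d : ℕ) : Set (Matrix (Fin n') (Fin n) ℝ) :=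
  convexHull ℝ {V | IsVertex d V}

/-- The Euclidean inner product `⟨G, P⟩ = ∑_{x,y} G_{y,x} P(y|x)`. -/
def bip {n n' : ℕ} (G P : Matrix (Fin n') (Fin n) ℝ) : ℝ :=
  ∑ x, ∑ y, G y x * P y x

/-- `(G, γ)` is a tight Bell inequality (facet) of `C_d^{n → n'}`: it is valid on the
signaling polytope and is saturated by `n (n' - 1)` affinely independent vertices. -/
def IsTightBell (n n' d : ℕ) (G : Matrix (Fin n') (Fin n) ℝ) (γ : ℝ) : Prop :=
  (∀ P ∈ signalingPolytope n n' d, bip G P ≤ γ) ∧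
  ∃ V : Fin (n * (n' - 1)) → Matrix (Fin n') (Fin n) ℝ,
    AffineIndependent ℝ V ∧ ∀ i, IsVertex d (V i) ∧ bip G (V i) = γ

open Module

/-- The deterministic channel `x ↦ f x`. -/
def functionMatrix {n n' : ℕ} (f : Fin n → Fin n') : Matrix (Fin n') (Fin n) ℝ :=
  ∑ x, Matrix.single (f x) x 1

theorem functionMatrix_apply {n n' : ℕ} (f : Fin n → Fin n') (y : Fin n') (x : Fin n) :
    functionMatrix f y x = if f x = y then 1 else 0 := by
  simp only [functionMatrix, Matrix.sum_apply, Matrix.single_apply]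
  rw [Finset.sum_eq_single x] <;> aesop

theorem functionMatrix_update {n n' : ℕ} (f : Fin n → Fin n') (x : Fin n) (y : Fin n') :
    functionMatrix (Function.update f x y) =
      functionMatrix f - Matrix.single (f x) x 1 + Matrix.single y x 1 := by
  ext i j
  simp only [Matrix.add_apply, Matrix.sub_apply, functionMatrix_apply, Matrix.single_apply,
    Function.update_apply]
  by_cases hj : j = x
  · subst hj
    simp
  · simp [hj, Ne.symm hj]

/-- The deterministic channels given by retractions of `Fin m` onto a subset of size `d`. -/
def retractionMatrices (m d : ℕ) : Set (Matrix (Fin m) (Fin m) ℝ) :=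
  {M | ∃ (S : Finset (Fin m)) (f : Fin m → Fin m), #S = d ∧ (∀ x, f x ∈ S) ∧
    (∀ x ∈ S, f x = x) ∧ M = functionMatrix f}

theorem isVertex_of_mem_retractionMatrices {m d : ℕ} {M : Matrix (Fin m) (Fin m) ℝ}
    (hM : M ∈ retractionMatrices m d) : IsVertex d M := by
  obtain ⟨S, f, hS, hf, -, rfl⟩ := hM
  refine ⟨⟨fun y x => ?_, fun x => ?_⟩, fun y x => ?_, ?_⟩
  · rw [functionMatrix_apply]
    split_ifs <;> norm_num
  · simp [functionMatrix_apply]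
  · rw [functionMatrix_apply]
    split_ifs <;> simp
  · rw [← hS, ← Set.ncard_coe_finset]
    refine Set.ncard_le_ncard ?_ S.finite_toSet
    rintro y ⟨x, hx⟩
    rw [functionMatrix_apply] at hx
    obtain rfl : f x = y := by
      by_contra h
      exact hx (if_neg h)
    exact hf x

theorem sum_diag_of_mem_retractionMatrices {m d : ℕ} {M : Matrix (Fin m) (Fin m) ℝ}
    (hM : M ∈ retractionMatrices m d) : ∑ y, M y y = d := by
  obtain ⟨S, f, hS, hf, hfix, rfl⟩ := hM
  have h : ∀ y, f y = y ↔ y ∈ S := fun y => ⟨fun h => h ▸ hf y, hfix y⟩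
  simp [functionMatrix_apply, h, hS]

theorem IsVertex.sum_diag_le {m d : ℕ} {V : Matrix (Fin m) (Fin m) ℝ} (hV : IsVertex d V) :
    ∑ y, V y y ≤ d := by
  classical
  obtain ⟨-, h01, hcard⟩ := hV
  calc ∑ y, V y y ≤ ∑ y, if ∃ x, V y x ≠ 0 then (1 : ℝ) else 0 := by
        refine Finset.sum_le_sum fun y _ => ?_
        split_ifs with h
        · rcases h01 y y with h0 | h0 <;> norm_num [h0]
        · push Not at h
          exact (h y).le
    _ = ({y : Fin m | ∃ x, V y x ≠ 0}.ncard : ℝ) := by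
        rw [Finset.sum_boole, Set.ncard_eq_toFinset_card']
        simp
    _ ≤ d := by exact_mod_cast hcard

theorem sum_diag_le_of_mem_signalingPolytope {m d : ℕ} {P : Matrix (Fin m) (Fin m) ℝ}
    (hP : P ∈ signalingPolytope m m d) : ∑ y, P y y ≤ d := by
  have hconv : Convex ℝ {P : Matrix (Fin m) (Fin m) ℝ | P.trace ≤ d} :=
    convex_halfSpace_le (Matrix.traceLinearMap (Fin m) ℝ ℝ).isLinear (d : ℝ)
  have hsub : {V : Matrix (Fin m) (Fin m) ℝ | IsVertex d V} ⊆ {P | P.trace ≤ d} :=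
    fun _ hV => hV.sum_diag_le
  exact convexHull_min hsub hconv hP

theorem bip_one {m : ℕ} (P : Matrix (Fin m) (Fin m) ℝ) : bip 1 P = ∑ y, P y y := by
  simp [bip, Matrix.one_apply]

theorem single_sub_single_mem_span {m d : ℕ} (hd : 1 < d) (hdm : d < m) {x y y' : Fin m}
    (hy : y ≠ x) (hy' : y' ≠ x) :
    Matrix.single y' x (1 : ℝ) - Matrix.single y x 1 ∈
      Submodule.span ℝ (retractionMatrices m d) := by
  obtain ⟨S, hyS, hSx, hS⟩ := Finset.exists_subsuperset_card_eq
    (s := {y, y'}) (t := univ.erase x) (n := d) (by grind)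
    (Finset.card_le_two.trans hd) (by simp; omega)
  have hxS : x ∉ S := fun h => by simpa using hSx h
  have hyS' : y ∈ S := hyS (by simp)
  have hyS'' : y' ∈ S := hyS (by simp)
  let f : Fin m → Fin m := fun z => if z ∈ S then z else y
  have hfS : ∀ z, f z ∈ S := by grind
  have hfix : ∀ z ∈ S, f z = z := by grind
  have hfx : f x = y := by grind
  have h := Submodule.sub_mem _
    (Submodule.subset_span (R := ℝ) (s := retractionMatrices m d)
      ⟨S, Function.update f x y', hS, by grind, by grind, rfl⟩)
    (Submodule.subset_span ⟨S, f, hS, hfS, hfix, rfl⟩)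
  rw [functionMatrix_update, hfx] at h
  convert h using 1
  abel

theorem sum_single_mem {m d : ℕ} (hd : 1 < d) {U : Submodule ℝ (Matrix (Fin m) (Fin m) ℝ)}
    (hU : Submodule.span ℝ (retractionMatrices m d) ≤ U)
    (hoff : ∀ x y, y ≠ x → Matrix.single y x (1 : ℝ) ∈ U) {S : Finset (Fin m)} (hS : #S = d) :
    ∑ x ∈ S, Matrix.single x x (1 : ℝ) ∈ U := by
  obtain ⟨s, hs⟩ : S.Nonempty := Finset.card_pos.mp (by omega)
  let f : Fin m → Fin m := fun z => if z ∈ S then z else s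
  have hfS : ∀ z, f z ∈ S := by grind
  have hfix : ∀ z ∈ S, f z = z := by grind
  have hmem : functionMatrix f ∈ U := hU (Submodule.subset_span ⟨S, f, hS, hfS, hfix, rfl⟩)
  rw [functionMatrix, ← Finset.sum_add_sum_compl S] at hmem
  have hc : ∑ x ∈ Sᶜ, Matrix.single (f x) x (1 : ℝ) ∈ U :=
    Submodule.sum_mem _ fun x hx => hoff _ _ fun h => Finset.mem_compl.mp hx (h ▸ hfS x)
  have := (Submodule.add_mem_iff_left U hc).mp hmem
  rwa [Finset.sum_congr rfl fun x hx => by rw [hfix x hx]] at this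

theorem single_self_mem {m d : ℕ} (hd : 1 < d) (hdm : d < m)
    {U : Submodule ℝ (Matrix (Fin m) (Fin m) ℝ)}
    (hU : Submodule.span ℝ (retractionMatrices m d) ≤ U)
    (hoff : ∀ x y, y ≠ x → Matrix.single y x (1 : ℝ) ∈ U) (x : Fin m) :
    Matrix.single x x (1 : ℝ) ∈ U := by
  have hdiff : ∀ y, Matrix.single y y (1 : ℝ) - Matrix.single x x 1 ∈ U := by
    intro y
    rcases eq_or_ne y x with rfl | hyx
    · simp
    obtain ⟨T, -, hT, hTcard⟩ := Finset.exists_subsuperset_card_eq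
      (s := ∅) (t := (univ.erase x).erase y) (n := d - 1) (by simp) (by simp)
      (by rw [Finset.card_erase_of_mem (by simpa using hyx)]; simp; omega)
    have hxT : x ∉ T := fun h => by simpa using hT h
    have hyT : y ∉ T := fun h => by simpa using hT h
    have hx := sum_single_mem hd hU hoff (S := insert x T) (by
      rw [Finset.card_insert_of_notMem hxT]; omega)
    have hy := sum_single_mem hd hU hoff (S := insert y T) (by
      rw [Finset.card_insert_of_notMem hyT]; omega)
    rw [Finset.sum_insert hxT] at hx
    rw [Finset.sum_insert hyT] at hy
    simpa using U.sub_mem hy hx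
  obtain ⟨S, -, hS⟩ := Finset.exists_subset_card_eq (s := (univ : Finset (Fin m))) (n := d)
    (by simpa using hdm.le)
  have h := U.sub_mem (sum_single_mem hd hU hoff hS)
    (U.sum_mem fun y (_ : y ∈ S) => hdiff y)
  rw [← Finset.sum_sub_distrib] at h
  simp only [sub_sub_cancel, Finset.sum_const, hS] at h
  rw [← Nat.cast_smul_eq_nsmul ℝ] at h
  exact (U.smul_mem_iff (by positivity)).mp h

theorem le_finrank_span_retractionMatrices {m d : ℕ} (hd : 1 < d) (hdm : d < m) :
    m * (m - 1) ≤ finrank ℝ (Submodule.span ℝ (retractionMatrices m d)) := by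
  have : Nontrivial (Fin m) := Fin.nontrivial_iff_two_le.mpr (by omega)
  choose c hc using fun x : Fin m => exists_ne x
  set W := Submodule.span ℝ (retractionMatrices m d)
  let b : Fin m → Matrix (Fin m) (Fin m) ℝ := fun x => Matrix.single (c x) x 1
  have hb : finrank ℝ (Submodule.span ℝ (Set.range b)) ≤ m :=
    (finrank_range_le_card b).trans_eq (Fintype.card_fin m)
  have hoff : ∀ x y, y ≠ x →
      Matrix.single y x (1 : ℝ) ∈ W ⊔ Submodule.span ℝ (Set.range b) := by
    intro x y hyx
    rw [← sub_add_cancel (Matrix.single y x (1 : ℝ)) (b x)]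
    exact Submodule.add_mem_sup (single_sub_single_mem_span hd hdm (hc x) hyx)
      (Submodule.subset_span ⟨x, rfl⟩)
  have htop : W ⊔ Submodule.span ℝ (Set.range b) = ⊤ := by
    refine Submodule.eq_top_iff'.mpr fun M => ?_
    rw [Matrix.matrix_eq_sum_single M]
    refine Submodule.sum_mem _ fun y _ => Submodule.sum_mem _ fun x _ => ?_
    rw [← mul_one (M y x), ← smul_eq_mul, ← Matrix.smul_single]
    refine Submodule.smul_mem _ _ ?_
    rcases eq_or_ne y x with rfl | hyx
    · exact single_self_mem hd hdm le_sup_left hoff y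
    · exact hoff x y hyx
  have h := Submodule.finrank_add_le_finrank_add_finrank W (Submodule.span ℝ (Set.range b))
  rw [htop, finrank_top, finrank_matrix] at h
  simp only [Fintype.card_fin, finrank_self, mul_one] at h
  rw [Nat.mul_sub_one]
  omega

theorem exists_affineIndependent_retractionMatrices {m d : ℕ} (hd : 1 < d) (hdm : d < m) :
    ∃ V : Fin (m * (m - 1)) → Matrix (Fin m) (Fin m) ℝ,
      AffineIndependent ℝ V ∧ ∀ i, V i ∈ retractionMatrices m d := by
  obtain ⟨v, hv, -, hli⟩ := Submodule.exists_fun_fin_finrank_span_eq ℝ (retractionMatrices m d)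
  have hle := le_finrank_span_retractionMatrices hd hdm
  exact ⟨v ∘ Fin.castLE hle, (hli.comp _ (Fin.castLE_injective hle)).affineIndependent,
    fun i => hv _⟩

/-- Maximum likelihood facets: for `n' > d > 1`, `(I_{n'}, d)` is a tight Bell
inequality of `C_d^{n' → n'}`; in particular every `P ∈ C_d^{n' → n'}` satisfies
`∑_y P(y|y) ≤ d`, and `n'(n'-1)` affinely independent vertices saturate the bound. -/
theorem mlFacet (n' d : ℕ) (hd : 1 < d) (hdn' : d < n') :
    IsTightBell n' n' d (1 : Matrix (Fin n') (Fin n') ℝ) (d : ℝ) ∧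
    (∀ P ∈ signalingPolytope n' n' d, ∑ y, P y y ≤ (d : ℝ)) ∧
    ∃ V : Fin (n' * (n' - 1)) → Matrix (Fin n') (Fin n') ℝ,
      AffineIndependent ℝ V ∧ ∀ i, IsVertex d (V i) ∧ ∑ y, V i y y = (d : ℝ) := by
  obtain ⟨V, hV, hmem⟩ := exists_affineIndependent_retractionMatrices hd hdn'
  have hsat := fun i => sum_diag_of_mem_retractionMatrices (hmem i)
  have hvert := fun i => isVertex_of_mem_retractionMatrices (hmem i)
  refine ⟨⟨fun P hP => ?_, V, hV, fun i => ⟨hvert i, ?_⟩⟩,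
    fun P hP => sum_diag_le_of_mem_signalingPolytope hP, V, hV, fun i => ⟨hvert i, hsat i⟩⟩
  · rw [bip_one]
    exact sum_diag_le_of_mem_signalingPolytope hP
  · rw [bip_one, hsat]
end

section
/- Ambiguous guessing facets (Proposition, Appendix C.3): Let n' and d be integers with n' − 2 ≥ d ≥ 2, and let G_?^{n',d} be the n'×(n'−1) matrix whose first n'−1 rows form (n'−d)·I_{n'−1} and whose last row has every entry equal to 1. Then (G_?^{n',d}, d(n'−d)) is a tight Bell inequality (facet) of the signaling polytope C_d^{(n'−1)→n'}. -/
open Finset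

/-- The 0/1 matrix of a deterministic map `f`, sending input `x` to output `f x`. -/
def deterministicChannel {n n' : ℕ} (f : Fin n → Fin n') : Matrix (Fin n') (Fin n) ℝ :=
  Matrix.of fun y x => if f x = y then 1 else 0

/-- The ambiguous guessing matrix with `m` inputs and `m + 1` outputs. -/
def guessingMatrix (m : ℕ) (c : ℝ) : Matrix (Fin (m + 1)) (Fin m) ℝ :=
  Matrix.of fun y x => if (y : ℕ) < m then (if (y : ℕ) = (x : ℕ) then c else 0) else 1

theorem guessingMatrix_castSucc {m : ℕ} (c : ℝ) (y x : Fin m) :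
    guessingMatrix m c y.castSucc x = if y = x then c else 0 := by
  simp [guessingMatrix, Fin.ext_iff]

theorem guessingMatrix_last {m : ℕ} (c : ℝ) (x : Fin m) :
    guessingMatrix m c (Fin.last m) x = 1 := by
  simp [guessingMatrix]

theorem bip_deterministicChannel {n n' : ℕ} (G : Matrix (Fin n') (Fin n) ℝ)
    (f : Fin n → Fin n') : bip G (deterministicChannel f) = ∑ x, G (f x) x := by
  simp [bip, deterministicChannel]

theorem support_deterministicChannel {n n' : ℕ} (f : Fin n → Fin n') :
    {y : Fin n' | ∃ x, deterministicChannel f y x ≠ 0} = (univ.image f : Finset (Fin n')) := by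
  ext y
  simp [deterministicChannel]

theorem isVertex_deterministicChannel {n n' d : ℕ} {f : Fin n → Fin n'}
    (hf : (univ.image f).card ≤ d) : IsVertex d (deterministicChannel f) := by
  refine ⟨⟨fun y x => ?_, fun x => ?_⟩, fun y x => ?_, ?_⟩
  · simp only [deterministicChannel, Matrix.of_apply]
    split_ifs <;> norm_num
  · simp [deterministicChannel]
  · simp only [deterministicChannel, Matrix.of_apply]
    split_ifs <;> simp
  · rwa [support_deterministicChannel, Set.ncard_coe_finset]

theorem IsVertex.exists_eq_deterministicChannel {n n' d : ℕ} {V : Matrix (Fin n') (Fin n) ℝ}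
    (hV : IsVertex d V) :
    ∃ f : Fin n → Fin n', V = deterministicChannel f ∧ (univ.image f).card ≤ d := by
  obtain ⟨⟨hnonneg, hsum⟩, h01, hcard⟩ := hV
  have hone : ∀ x, ∃ y, V y x = 1 := by
    intro x
    by_contra! h
    have hzero : ∀ y, V y x = 0 := fun y => (h01 y x).resolve_right (h y)
    simpa [hzero] using hsum x
  choose f hf using hone
  have hVf : V = deterministicChannel f := by
    ext y x
    simp only [deterministicChannel, Matrix.of_apply]
    split_ifs with h
    · rw [← h, hf]
    · refine (h01 y x).resolve_right fun hy => ?_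
      have hle := Finset.sum_le_univ_sum_of_nonneg (s := {f x, y}) fun y => hnonneg y x
      rw [Finset.sum_pair h, hsum, hf, hy] at hle
      norm_num at hle
  refine ⟨f, hVf, ?_⟩
  rwa [hVf, support_deterministicChannel, Set.ncard_coe_finset] at hcard

theorem bip_le_of_forall_isVertex {n n' d : ℕ} {G : Matrix (Fin n') (Fin n) ℝ} {γ : ℝ}
    (h : ∀ V, IsVertex d V → bip G V ≤ γ) :
    ∀ P ∈ signalingPolytope n n' d, bip G P ≤ γ := by
  have hlin : IsLinearMap ℝ (bip G) :=
    ⟨fun P Q => by simp [bip, mul_add, sum_add_distrib],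
      fun r P => by simp [bip, mul_sum, mul_left_comm]⟩
  exact fun P hP => convexHull_min h (convex_halfSpace_le hlin γ) hP

theorem sum_guessingMatrix {m : ℕ} (c : ℝ) (f : Fin m → Fin (m + 1)) :
    ∑ x, guessingMatrix m c (f x) x =
      c * (univ.filter fun x => f x = x.castSucc).card +
        (univ.filter fun x => f x = Fin.last m).card := by
  have hterm : ∀ y x, guessingMatrix m c y x =
      c * (if y = x.castSucc then 1 else 0) + (if y = Fin.last m then 1 else 0) := by
    intro y x
    induction y using Fin.lastCases with
    | last => simp [guessingMatrix_last, (Fin.castSucc_ne_last x).symm]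
    | cast y => simp [guessingMatrix_castSucc, Fin.castSucc_ne_last]
  simp only [hterm, sum_add_distrib, ← mul_sum, sum_boole]

theorem sum_guessingMatrix_le {m d : ℕ} (hdm : d + 1 ≤ m) {f : Fin m → Fin (m + 1)}
    (hf : (univ.image f).card ≤ d) :
    ∑ x, guessingMatrix m ((m : ℝ) + 1 - d) (f x) x ≤ d * ((m : ℝ) + 1 - d) := by
  rw [sum_guessingMatrix]
  set F := univ.filter fun x => f x = x.castSucc
  set L := univ.filter fun x => f x = Fin.last m
  have hFsub : F.map Fin.castSuccEmb ⊆ univ.image f := by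
    intro y hy
    obtain ⟨x, hx, rfl⟩ := mem_map.1 hy
    exact mem_image.2 ⟨x, mem_univ _, (mem_filter.1 hx).2⟩
  have hdm' : (d : ℝ) + 1 ≤ m := by exact_mod_cast hdm
  rcases L.eq_empty_or_nonempty with hL | ⟨z, hz⟩
  · have hF : (F.card : ℝ) ≤ d := by
      exact_mod_cast (card_map Fin.castSuccEmb ▸ card_le_card hFsub).trans hf
    rw [hL, card_empty]
    push_cast
    nlinarith
  · have hlast : Fin.last m ∉ F.map Fin.castSuccEmb := by
      simp [Fin.castSucc_ne_last]
    have hins : insert (Fin.last m) (F.map Fin.castSuccEmb) ⊆ univ.image f :=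
      insert_subset (mem_image.2 ⟨z, mem_univ _, (mem_filter.1 hz).2⟩) hFsub
    have hF : (F.card : ℝ) + 1 ≤ d := by
      have := (card_le_card hins).trans hf
      rw [card_insert_of_notMem hlast, card_map] at this
      exact_mod_cast this
    have hdisj : Disjoint F L := by
      refine disjoint_left.2 fun x hxF hxL => Fin.castSucc_ne_last x ?_
      exact (mem_filter.1 hxF).2.symm.trans (mem_filter.1 hxL).2
    have hFL : (F.card : ℝ) + L.card ≤ m := by
      have := card_le_univ (F ∪ L)
      rw [card_union_of_disjoint hdisj, Fintype.card_fin] at this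
      exact_mod_cast this
    nlinarith

/-- The maps whose deterministic channels saturate the ambiguous guessing inequality. -/
def IsSaturating {m : ℕ} (d : ℕ) (f : Fin m → Fin (m + 1)) : Prop :=
  (univ.image f).card ≤ d ∧
    ∑ x, guessingMatrix m ((m : ℝ) + 1 - d) (f x) x = d * ((m : ℝ) + 1 - d)

theorem isSaturating_of_retraction {m d : ℕ} {S : Finset (Fin m)} (hS : S.card = d)
    {r : Fin m → Fin m} (hr : ∀ x, r x ∈ S) (hfix : ∀ x ∈ S, r x = x) :
    IsSaturating d fun x => (r x).castSucc := by
  refine ⟨?_, ?_⟩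
  · rw [← hS, ← card_map (s := S) Fin.castSuccEmb]
    refine card_le_card (t := S.map Fin.castSuccEmb) fun y hy => ?_
    obtain ⟨x, -, rfl⟩ := mem_image.1 hy
    exact mem_map_of_mem Fin.castSuccEmb (hr x)
  · have hfilter : (univ.filter fun x => r x = x) = S := by
      ext x
      simp only [mem_filter, mem_univ, true_and]
      exact ⟨fun h => h ▸ hr x, hfix x⟩
    simp [sum_guessingMatrix, Fin.castSucc_ne_last, hfilter, hS, mul_comm]

theorem isSaturating_ambiguous {m d : ℕ} {S : Finset (Fin m)} (hS : S.card + 1 = d) :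
    IsSaturating d fun x => if x ∈ S then x.castSucc else Fin.last m := by
  refine ⟨?_, ?_⟩
  · have hsub : (univ.image fun x => if x ∈ S then x.castSucc else Fin.last m) ⊆
        insert (Fin.last m) (S.map Fin.castSuccEmb) := by
      intro y hy
      obtain ⟨x, -, rfl⟩ := mem_image.1 hy
      by_cases hx : x ∈ S <;> simp [hx]
    calc _ ≤ _ := card_le_card hsub
      _ ≤ _ := card_insert_le _ _
      _ = d := by rw [card_map, hS]
  · have hfix : (univ.filter fun x : Fin m =>
        (if x ∈ S then x.castSucc else Fin.last m) = x.castSucc) = S := by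
      ext x
      by_cases hx : x ∈ S <;> simp [hx, (Fin.castSucc_ne_last x).symm]
    have hlast : (univ.filter fun x : Fin m =>
        (if x ∈ S then x.castSucc else Fin.last m) = Fin.last m) = Sᶜ := by
      ext x
      by_cases hx : x ∈ S <;> simp [hx]
    have hcompl : (S.card : ℝ) + (Sᶜ).card = m := by
      exact_mod_cast (card_add_card_compl S).trans (Fintype.card_fin m)
    have hSd : (S.card : ℝ) + 1 = d := by exact_mod_cast hS
    rw [sum_guessingMatrix, hfix, hlast, ← hSd, ← hcompl]
    ring

theorem eq_zero_of_forall_card_sum_eq_zero {ι : Type*} [Fintype ι] [DecidableEq ι]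
    {k : ℕ} (hk : 0 < k) (hkι : k < Fintype.card ι) {h : ι → ℝ}
    (hsum : ∀ T : Finset ι, T.card = k → ∑ x ∈ T, h x = 0) (a : ι) : h a = 0 := by
  have hconst : ∀ b, h b = h a := by
    intro b
    by_cases hab : b = a
    · rw [hab]
    obtain ⟨T, hT, hTk⟩ := exists_subset_card_eq (s := ({b, a} : Finset ι)ᶜ) (n := k - 1) (by
      rw [card_compl, card_pair hab]
      omega)
    have hb : b ∉ T := fun hb => by simpa using hT hb
    have ha : a ∉ T := fun ha => by simpa using hT ha
    have hsum_b := hsum (insert b T) (by rw [card_insert_of_notMem hb]; omega)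
    have hsum_a := hsum (insert a T) (by rw [card_insert_of_notMem ha]; omega)
    rw [sum_insert hb] at hsum_b
    rw [sum_insert ha] at hsum_a
    linarith
  obtain ⟨T, -, hT⟩ := exists_subset_card_eq (s := (univ : Finset ι)) (n := k) hkι.le
  have hTa := hsum T hT
  simp only [hconst, sum_const, hT, nsmul_eq_mul] at hTa
  exact (mul_eq_zero.1 hTa).resolve_left (by exact_mod_cast hk.ne')

theorem eq_zero_of_sum_isSaturating_eq_zero {m d : ℕ} (hd : 2 ≤ d) (hdm : d + 1 ≤ m)
    {K : Fin (m + 1) → Fin m → ℝ} (hlast : ∀ x, K (Fin.last m) x = 0)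
    (hK : ∀ f, IsSaturating d f → ∑ x, K (f x) x = 0) (y x : Fin m) :
    K y.castSucc x = 0 := by
  have hdiag : ∀ x : Fin m, K x.castSucc x = 0 := by
    refine eq_zero_of_forall_card_sum_eq_zero (k := d - 1) (by omega)
      (by rw [Fintype.card_fin]; omega) fun S hS => ?_
    rw [← hK _ (isSaturating_ambiguous (S := S) (by omega)), ← sum_subset (subset_univ S)]
    · exact sum_congr rfl fun x hx => by rw [if_pos hx]
    · intro x _ hx
      rw [if_neg hx, hlast]
  have hoff : ∀ x s t : Fin m, s ≠ x → t ≠ x → K s.castSucc x = K t.castSucc x := by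
    intro x s t hs ht
    by_cases hst : s = t
    · rw [hst]
    obtain ⟨S, hsS, hSx, hSd⟩ :=
      exists_subsuperset_card_eq (s := ({s, t} : Finset (Fin m))) (t := {x}ᶜ) (n := d)
        (by intro z; simp; rintro (rfl | rfl) <;> assumption)
        (by rw [card_pair hst]; exact hd)
        (by rw [card_compl, card_singleton, Fintype.card_fin]; omega)
    have hsmem : s ∈ S := hsS (by simp)
    have htmem : t ∈ S := hsS (by simp)
    have hx : x ∉ S := fun h => by simpa using hSx h
    have hexpand : ∀ u ∈ S, K u.castSucc x +
        ∑ z ∈ univ.erase x, K (if z ∈ S then z else s).castSucc z = 0 := by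
      intro u hu
      rw [← hK _ (isSaturating_of_retraction hSd
        (r := fun z => if z = x then u else if z ∈ S then z else s) ?_ ?_),
        ← add_sum_erase univ _ (mem_univ x)]
      · congr 1
        · simp
        · exact sum_congr rfl fun z hz => by rw [if_neg (ne_of_mem_erase hz)]
      · intro z
        split_ifs <;> assumption
      · intro z hz
        have hzx : z ≠ x := fun h => hx (h ▸ hz)
        rw [if_neg hzx, if_pos hz]
    linarith [hexpand s hsmem, hexpand t htmem]
  have : Nontrivial (Fin m) := Fin.nontrivial_iff_two_le.2 (by omega)
  choose r hr using fun x : Fin m => exists_ne x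
  have hzero : ∀ x : Fin m, K (r x).castSucc x = 0 := by
    refine eq_zero_of_forall_card_sum_eq_zero (k := m - d) (by omega)
      (by rw [Fintype.card_fin]; omega) fun T hT => ?_
    have hTc : (Tᶜ).card = d := by
      rw [card_compl, Fintype.card_fin]
      omega
    obtain ⟨s, hs⟩ : (Tᶜ).Nonempty := card_pos.1 (by omega)
    rw [← hK _ (isSaturating_of_retraction hTc (r := fun z => if z ∈ T then s else z) ?_ ?_),
      ← sum_subset (subset_univ T)]
    · refine sum_congr rfl fun z hz => ?_
      rw [if_pos hz]
      exact hoff z _ _ (hr z) fun h => (mem_compl.1 hs) (h ▸ hz)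
    · intro z _ hz
      rw [if_neg hz, hdiag]
    · intro z
      split_ifs with hz
      · exact hs
      · exact mem_compl.2 hz
    · intro z hz
      exact if_neg (mem_compl.1 hz)
  by_cases hyx : y = x
  · rw [hyx, hdiag]
  · rw [hoff x y (r x) hyx (hr x), hzero]

/-- The linear map deleting the last row of a matrix. -/
def dropLastRow (m : ℕ) : Matrix (Fin (m + 1)) (Fin m) ℝ →ₗ[ℝ] Matrix (Fin m) (Fin m) ℝ where
  toFun M := M.submatrix Fin.castSucc id
  map_add' _ _ := rfl
  map_smul' _ _ := rfl

theorem dropLastRow_apply {m : ℕ} (M : Matrix (Fin (m + 1)) (Fin m) ℝ) (y x : Fin m) :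
    dropLastRow m M y x = M y.castSucc x := rfl

theorem span_dropLastRow_isSaturating {m d : ℕ} (hd : 2 ≤ d) (hdm : d + 1 ≤ m) :
    Submodule.span ℝ (Set.range fun f : {f : Fin m → Fin (m + 1) // IsSaturating d f} =>
      dropLastRow m (deterministicChannel f.1)) = ⊤ := by
  by_contra htop
  obtain ⟨φ, hφ, hker⟩ := Submodule.exists_le_ker_of_lt_top _ (lt_top_iff_ne_top.2 htop)
  refine hφ (Matrix.ext_linearMap ℝ fun y x => LinearMap.ext_ring ?_)
  let K : Fin (m + 1) → Fin m → ℝ := fun y x =>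
    Fin.lastCases (motive := fun _ => ℝ) 0 (fun y => φ (Matrix.single y x 1)) y
  have hcast : ∀ y x, K (Fin.castSucc y) x = φ (Matrix.single y x 1) := fun y x => by simp [K]
  have hzero : K y.castSucc x = 0 := by
    refine eq_zero_of_sum_isSaturating_eq_zero hd hdm (fun x => by simp [K]) (fun f hf => ?_) y x
    have hφf : φ (dropLastRow m (deterministicChannel f)) = 0 :=
      hker (Submodule.subset_span ⟨⟨f, hf⟩, rfl⟩)
    have hdecomp : dropLastRow m (deterministicChannel f) =
        ∑ x, ∑ y : Fin m, (if f x = y.castSucc then (1 : ℝ) else 0) • Matrix.single y x 1 := by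
      rw [Matrix.matrix_eq_sum_single (dropLastRow m (deterministicChannel f)), sum_comm]
      simp only [dropLastRow_apply, deterministicChannel, Matrix.of_apply, Matrix.smul_single,
        smul_eq_mul, mul_one]
    rw [← hφf, hdecomp]
    simp only [map_sum, map_smul, smul_eq_mul]
    refine sum_congr rfl fun x _ => ?_
    generalize f x = z
    induction z using Fin.lastCases with
    | last => simp [K, (Fin.castSucc_ne_last _).symm]
    | cast z => simp [hcast]
  simpa [hcast] using hzero

theorem exists_affineIndependent_isSaturating {m d : ℕ} (hd : 2 ≤ d) (hdm : d + 1 ≤ m) :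
    ∃ f : Fin (m * m) → Fin m → Fin (m + 1),
      AffineIndependent ℝ (fun i => deterministicChannel (f i)) ∧ ∀ i, IsSaturating d (f i) := by
  obtain ⟨κ, a, -, hspan, hli⟩ := exists_linearIndependent' ℝ
    fun f : {f : Fin m → Fin (m + 1) // IsSaturating d f} =>
      dropLastRow m (deterministicChannel f.1)
  rw [span_dropLastRow_isSaturating hd hdm] at hspan
  let b := Module.Basis.mk hli hspan.ge
  have : Fintype κ := FiniteDimensional.fintypeBasisIndex b
  have hcard : Fintype.card κ = m * m := by
    rw [← Module.finrank_eq_card_basis b, Module.finrank_matrix]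
    simp
  let e : Fin (m * m) ≃ κ := (Fintype.equivFinOfCardEq hcard).symm
  refine ⟨fun i => (a (e i)).1, ?_, fun i => (a (e i)).2⟩
  exact ((LinearIndependent.of_comp (dropLastRow m) hli).comp e e.injective).affineIndependent

theorem isTightBell_guessingMatrix {m d : ℕ} (hd : 2 ≤ d) (hdm : d + 1 ≤ m) :
    IsTightBell m (m + 1) d (guessingMatrix m ((m : ℝ) + 1 - d)) (d * ((m : ℝ) + 1 - d)) := by
  refine ⟨bip_le_of_forall_isVertex fun V hV => ?_, ?_⟩
  · obtain ⟨f, rfl, hf⟩ := hV.exists_eq_deterministicChannel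
    rw [bip_deterministicChannel]
    exact sum_guessingMatrix_le hdm hf
  · obtain ⟨f, haff, hf⟩ := exists_affineIndependent_isSaturating hd hdm
    exact ⟨fun i => deterministicChannel (f i), haff, fun i =>
      ⟨isVertex_deterministicChannel (hf i).1, (bip_deterministicChannel _ _).trans (hf i).2⟩⟩

/-- Ambiguous guessing facets: for `n' - 2 ≥ d ≥ 2`, the `n' × (n'-1)` matrix whose
first `n' - 1` rows form `(n'-d)·I_{n'-1}` and whose last row is all ones, together
with the bound `d(n'-d)`, is a tight Bell inequality of `C_d^{(n'-1) → n'}`. -/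
theorem ambiguousGuessingFacet (n' d : ℕ) (hd : 2 ≤ d) (hdn' : d + 2 ≤ n') :
    IsTightBell (n' - 1) n' d
      (Matrix.of fun (y : Fin n') (x : Fin (n' - 1)) =>
        if (y : ℕ) < n' - 1 then
          (if (y : ℕ) = (x : ℕ) then (n' : ℝ) - (d : ℝ) else 0)
        else 1)
      ((d : ℝ) * ((n' : ℝ) - (d : ℝ))) := by
  obtain ⟨m, rfl⟩ : ∃ m, n' = m + 1 := ⟨n' - 1, by omega⟩
  rw [Nat.cast_add_one]
  exact isTightBell_guessingMatrix hd (by omega)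
end

section
/- Lemma (Appendix E, Lemma 3): For all positive integers n and n' with n' ≥ 2, every extreme point V of the maximum likelihood polytope M_{n'−1}^{n→n'} is an extreme point of the signaling polytope C_{n'−1}^{n→n'}; that is, V is a column-stochastic matrix with 0/1 entries having at most n'−1 nonzero rows. -/
open Finset

/-- Maximum likelihood score: `∑_y max_x P(y|x)`. -/
noncomputable def mlScore {n n' : ℕ} (P : Matrix (Fin n') (Fin n) ℝ) : ℝ :=
  ∑ y, ⨆ x, P y x

/-- The maximum likelihood polytope `M_d^{n → n'}`. -/
def mlPolytope (n n' d : ℕ) : Set (Matrix (Fin n') (Fin n) ℝ) :=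
  {P | IsChannel P ∧ mlScore P ≤ (d : ℝ)}

/-- If two probability vectors satisfy `p i + w i ≤ 1` for all `i`, they admit a coupling
that puts no mass on the diagonal. -/
theorem exists_offDiag_coupling {ι : Type*} [Fintype ι] [DecidableEq ι] {p w : ι → ℝ}
    (hp : ∀ i, 0 ≤ p i) (hw : ∀ i, 0 ≤ w i) (hp1 : ∑ i, p i = 1) (hw1 : ∑ i, w i = 1)
    (hpw : ∀ i, p i + w i ≤ 1) :
    ∃ c : ι → ι → ℝ, (∀ i j, 0 ≤ c i j) ∧ (∀ i, ∑ j, c i j = p i) ∧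
      (∀ j, ∑ i, c i j = w j) ∧ ∀ i, c i i = 0 := by
  -- a coupling of minimal trace works
  let K : Set (ι → ι → ℝ) := {c | (∀ i j, 0 ≤ c i j) ∧ (∀ i, ∑ j, c i j = p i) ∧
      ∀ j, ∑ i, c i j = w j}
  have hKsub : K ⊆ Set.Icc (fun _ _ => 0) (fun i _ => p i) := fun c hc =>
    ⟨fun i j => hc.1 i j, fun i j => by
      change c i j ≤ p i
      rw [← hc.2.1 i]
      exact single_le_sum (f := fun j => c i j) (fun j _ => hc.1 i j) (mem_univ j)⟩
  have hKclosed : IsClosed K := by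
    have h : K = (⋂ i, ⋂ j, {c : ι → ι → ℝ | 0 ≤ c i j}) ∩
        ((⋂ i, {c : ι → ι → ℝ | ∑ j, c i j = p i}) ∩
          ⋂ j, {c : ι → ι → ℝ | ∑ i, c i j = w j}) := by
      ext c; simp [K]
    rw [h]
    refine (isClosed_iInter fun i => isClosed_iInter fun j =>
      isClosed_le (by fun_prop) (by fun_prop)).inter
      ((isClosed_iInter fun i => isClosed_eq (by fun_prop) (by fun_prop)).inter
        (isClosed_iInter fun j => isClosed_eq (by fun_prop) (by fun_prop)))
  have hKne : K.Nonempty := ⟨fun i j => p i * w j, fun i j => mul_nonneg (hp i) (hw j),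
    fun i => by rw [← mul_sum, hw1, mul_one], fun j => by rw [← sum_mul, hp1, one_mul]⟩
  obtain ⟨c, hc, hmin⟩ := (isCompact_Icc.of_isClosed_subset hKclosed hKsub).exists_isMinOn hKne
    (f := fun c => ∑ i, c i i) (by fun_prop)
  obtain ⟨h0, hrow, hcol⟩ := hc
  refine ⟨c, h0, hrow, hcol, fun y => ?_⟩
  by_contra hy
  have hypos : 0 < c y y := lt_of_le_of_ne (h0 y y) (Ne.symm hy)
  obtain ⟨a, ha, b, hb, hab⟩ : ∃ a, a ≠ y ∧ ∃ b, b ≠ y ∧ 0 < c a b := by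
    by_contra! hcon
    have hz : ∀ a, a ≠ y → p a = c a y := fun a ha => by
      rw [← hrow a]
      exact Fintype.sum_eq_single y fun b hb => le_antisymm (hcon a ha b hb) (h0 a b)
    have h1 : ∑ i ∈ univ.erase y, p i = ∑ i ∈ univ.erase y, c i y :=
      sum_congr rfl fun i hi => hz i (ne_of_mem_erase hi)
    have h2 := add_sum_erase univ p (mem_univ y)
    have h3 := add_sum_erase univ (fun i => c i y) (mem_univ y)
    simp only [hcol] at h3
    linarith [hpw y]
  -- shift mass from `(y, y)` and `(a, b)` to `(a, y)` and `(y, b)`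
  let ε := min (c y y) (c a b)
  have hε : 0 < ε := lt_min hypos hab
  have hε1 : ε ≤ c y y := min_le_left _ _
  have hε2 : ε ≤ c a b := min_le_right _ _
  let u : ι → ℝ := fun i => (if i = a then 1 else 0) - (if i = y then 1 else 0)
  let v : ι → ℝ := fun j => (if j = y then 1 else 0) - (if j = b then 1 else 0)
  have hu : ∑ i, u i = 0 := by simp [u]
  have hv : ∑ i, v i = 0 := by simp [v]
  have hmem : (fun i j => c i j + ε * (u i * v j)) ∈ K := by
    refine ⟨fun i j => ?_, fun i => ?_, fun j => ?_⟩
    · have := h0 i j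
      simp only [u, v]
      split_ifs <;> subst_vars <;> first | contradiction | linarith
    · rw [sum_add_distrib, ← mul_sum, ← mul_sum, hv, hrow]; ring
    · rw [sum_add_distrib, ← mul_sum, ← sum_mul, hu, hcol]; ring
  have hle : ∑ i, c i i ≤ ∑ i, (c i i + ε * (u i * v i)) := hmin hmem
  have huv : ∑ i, u i * v i ≤ ∑ i, -(if i = y then (1 : ℝ) else 0) := by
    refine sum_le_sum fun i _ => ?_
    simp only [u, v]
    split_ifs <;> subst_vars <;> first | contradiction | norm_num
  rw [sum_add_distrib, ← mul_sum] at hle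
  simp only [sum_neg_distrib, sum_ite_eq', mem_univ, if_true] at huv
  nlinarith

theorem IsChannel.le_one {n n' : ℕ} {P : Matrix (Fin n') (Fin n) ℝ} (hP : IsChannel P)
    (y : Fin n') (x : Fin n) : P y x ≤ 1 := by
  rw [← hP.2 x]
  exact single_le_sum (f := fun y => P y x) (fun y _ => hP.1 y x) (mem_univ y)

/-- A channel that never outputs `y` is a mixture of deterministic ones. -/
theorem IsChannel.mem_signalingPolytope_of_row_eq_zero {n n' : ℕ}
    {Q : Matrix (Fin n') (Fin n) ℝ} (hQ : IsChannel Q) (y : Fin n') (hy : ∀ x, Q y x = 0) :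
    Q ∈ signalingPolytope n n' (n' - 1) := by
  let T : Set (Fin n' → ℝ) := {v | ∃ z, z ≠ y ∧ v = Pi.single z 1}
  have hcol : (fun x z => Q z x) ∈ convexHull ℝ (Set.univ.pi fun _ : Fin n => T) := by
    rw [convexHull_pi]
    intro x _
    have hsum : (fun z => Q z x) = ∑ z ∈ univ.erase y, Q z x • (Pi.single z 1 : Fin n' → ℝ) := by
      rw [sum_erase _ (by rw [hy, zero_smul])]
      ext z
      simp [Finset.sum_apply, Pi.single_apply]
    change (fun z => Q z x) ∈ _
    rw [hsum]
    refine (convex_convexHull ℝ T).sum_mem (fun z _ => hQ.1 z x) ?_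
      fun z hz => subset_convexHull ℝ T ⟨z, ne_of_mem_erase hz, rfl⟩
    exact (sum_erase (f := fun z => Q z x) univ (hy x)).trans (hQ.2 x)
  let L : (Fin n → Fin n' → ℝ) →ₗ[ℝ] Matrix (Fin n') (Fin n) ℝ :=
    { toFun := fun f => Matrix.of fun z x => f x z
      map_add' := fun _ _ => rfl
      map_smul' := fun _ _ => rfl }
  have hmem : Q ∈ L '' convexHull ℝ (Set.univ.pi fun _ : Fin n => T) := ⟨_, hcol, rfl⟩
  rw [LinearMap.image_convexHull] at hmem
  refine convexHull_mono ?_ hmem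
  rintro _ ⟨f, hf, rfl⟩
  choose g hgy hg using fun x => hf x (Set.mem_univ x)
  have hL : ∀ z x, L f z x = if z = g x then 1 else 0 := fun z x => by
    change f x z = _
    rw [hg x, Pi.single_apply]
  refine ⟨⟨fun z x => ?_, fun x => ?_⟩, fun z x => ?_, ?_⟩
  · rw [hL]; split_ifs <;> norm_num
  · simp [hL]
  · rw [hL]; split_ifs <;> simp
  · have hsub : {z : Fin n' | ∃ x, L f z x ≠ 0} ⊆ ((univ.erase y : Finset (Fin n')) : Set _) := by
      rintro z ⟨x, hx⟩
      rw [hL] at hx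
      have : z = g x := by by_contra h; simp [h] at hx
      simp [this, hgy]
    refine (Set.ncard_le_ncard hsub (Finset.finite_toSet _)).trans ?_
    rw [Set.ncard_coe_finset, card_erase_of_mem (mem_univ y), card_univ, Fintype.card_fin]

theorem mlPolytope_subset_signalingPolytope {n n' : ℕ} (hn : 0 < n) (hn' : 1 ≤ n') :
    mlPolytope n n' (n' - 1) ⊆ signalingPolytope n n' (n' - 1) := by
  rintro P ⟨hP, hml⟩
  have : Nonempty (Fin n) := ⟨⟨0, hn⟩⟩
  let r : Fin n' → ℝ := fun y => 1 - ⨆ x, P y x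
  have hr0 : ∀ y, 0 ≤ r y := fun y => sub_nonneg.2 (ciSup_le fun x => hP.le_one y x)
  have hrP : ∀ y x, P y x + r y ≤ 1 := fun y x => by
    have := le_ciSup (Set.finite_range fun x => P y x).bddAbove x
    simp only [r]
    linarith
  have hR : 1 ≤ ∑ y, r y := by
    simp only [r, sum_sub_distrib, sum_const, card_univ, Fintype.card_fin, nsmul_eq_mul, mul_one]
    unfold mlScore at hml
    push_cast [hn'] at hml
    linarith
  let w : Fin n' → ℝ := fun y => r y / ∑ z, r z
  have hw0 : ∀ y, 0 ≤ w y := fun y => div_nonneg (hr0 y) (by linarith)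
  have hw1 : ∑ y, w y = 1 := by
    simp only [w, ← sum_div]
    exact div_self (by linarith)
  have hwP : ∀ x y, P y x + w y ≤ 1 := fun x y =>
    (add_le_add_right (div_le_self (hr0 y) hR) _).trans (hrP y x)
  choose c hc0 hcrow hccol hcdiag using fun x =>
    exists_offDiag_coupling (fun y => hP.1 y x) hw0 (hP.2 x) hw1 (hwP x)
  let Q : Fin n' → Matrix (Fin n') (Fin n) ℝ := fun y => Matrix.of fun z x => c x z y / w y
  have hwQ : ∀ y z x, w y * Q y z x = c x z y := fun y z x => by
    simp only [Q, Matrix.of_apply]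
    by_cases h : w y = 0
    · have h' := hccol x y
      rw [h, sum_eq_zero_iff_of_nonneg fun i _ => hc0 x i y] at h'
      rw [h, zero_mul, h' z (mem_univ z)]
    · field_simp
  have hPsum : P = ∑ y with w y ≠ 0, w y • Q y := by
    have h : ∀ y ∈ univ, w y • Q y ≠ 0 → w y ≠ 0 := fun y _ h hy => h (by rw [hy, zero_smul])
    rw [sum_filter_of_ne h]
    ext z x
    simp only [Matrix.sum_apply, Matrix.smul_apply, smul_eq_mul, hwQ, hcrow]
  rw [hPsum]
  refine (convex_convexHull ℝ _).sum_mem (fun y _ => hw0 y) ?_ fun y hy => ?_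
  · rw [sum_filter_ne_zero, hw1]
  · have hy : w y ≠ 0 := (mem_filter.1 hy).2
    refine IsChannel.mem_signalingPolytope_of_row_eq_zero
      ⟨fun z x => div_nonneg (hc0 x z y) (hw0 y), fun x => ?_⟩ y fun x => ?_
    · simp only [Q, Matrix.of_apply, ← sum_div, hccol, div_self hy]
    · simp only [Q, Matrix.of_apply, hcdiag, zero_div]

theorem convex_mlPolytope {n n' : ℕ} (hn : 0 < n) (d : ℕ) : Convex ℝ (mlPolytope n n' d) := by
  rintro P ⟨hP, hPd⟩ Q ⟨hQ, hQd⟩ a b ha hb hab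
  have : Nonempty (Fin n) := ⟨⟨0, hn⟩⟩
  refine ⟨⟨fun y x => ?_, fun x => ?_⟩, ?_⟩
  · exact add_nonneg (mul_nonneg ha (hP.1 y x)) (mul_nonneg hb (hQ.1 y x))
  · simp only [Matrix.add_apply, Matrix.smul_apply, smul_eq_mul, sum_add_distrib, ← mul_sum,
      hP.2, hQ.2, mul_one, hab]
  · calc mlScore (a • P + b • Q) ≤ ∑ y, (a * ⨆ x, P y x) + ∑ y, (b * ⨆ x, Q y x) := by
          rw [← sum_add_distrib]
          refine sum_le_sum fun y _ => ciSup_le fun x => add_le_add ?_ ?_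
          · exact mul_le_mul_of_nonneg_left
              (le_ciSup (Set.finite_range fun x => P y x).bddAbove x) ha
          · exact mul_le_mul_of_nonneg_left
              (le_ciSup (Set.finite_range fun x => Q y x).bddAbove x) hb
      _ = a * mlScore P + b * mlScore Q := by simp only [mlScore, mul_sum]
      _ ≤ a * d + b * d := by gcongr
      _ = d := by rw [← add_mul, hab, one_mul]

theorem IsVertex.mem_mlPolytope {n n' d : ℕ} (hn : 0 < n) {V : Matrix (Fin n') (Fin n) ℝ}
    (hV : IsVertex d V) : V ∈ mlPolytope n n' d := by
  classical
  have : Nonempty (Fin n) := ⟨⟨0, hn⟩⟩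
  obtain ⟨hV, -, hd⟩ := hV
  refine ⟨hV, ?_⟩
  calc mlScore V ≤ ∑ y, if ∃ x, V y x ≠ 0 then (1 : ℝ) else 0 := by
        refine sum_le_sum fun y _ => ciSup_le fun x => ?_
        split_ifs with h
        · exact hV.le_one y x
        · push Not at h
          exact (h x).le
    _ = ({y : Fin n' | ∃ x, V y x ≠ 0}.ncard : ℝ) := by
        rw [sum_boole, ← Set.ncard_coe_finset, coe_filter_univ]
    _ ≤ d := by exact_mod_cast hd

theorem mlPolytope_eq_signalingPolytope {n n' : ℕ} (hn : 0 < n) (hn' : 1 ≤ n') :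
    mlPolytope n n' (n' - 1) = signalingPolytope n n' (n' - 1) :=
  (mlPolytope_subset_signalingPolytope hn hn').antisymm
    (convexHull_min (fun _ hV => hV.mem_mlPolytope hn) (convex_mlPolytope hn _))

/-- Lemma 3 (Appendix E): every extreme point of `M_{n'-1}^{n → n'}` is an extreme
point of `C_{n'-1}^{n → n'}`, i.e. a column-stochastic 0/1 matrix with at most
`n' - 1` nonzero rows. -/
theorem extremePoint_mlPolytope (n n' : ℕ) (hn : 0 < n) (hn' : 2 ≤ n')
    (V : Matrix (Fin n') (Fin n) ℝ)
    (hV : V ∈ Set.extremePoints ℝ (mlPolytope n n' (n' - 1))) :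
    V ∈ Set.extremePoints ℝ (signalingPolytope n n' (n' - 1)) ∧
      IsVertex (n' - 1) V := by
  rw [mlPolytope_eq_signalingPolytope hn (by omega)] at hV
  exact ⟨hV, extremePoints_convexHull_subset (A := {V | IsVertex (n' - 1) V}) hV⟩
end

section
/- Proposition (Appendix E, partial-ML): Let n' ≥ n ≥ 2 be integers and let A_∩^{n→n'} := ⋂_{k=n}^{n'} A_{k,n−1}^{n→n'}. If V is an extreme point of A_∩^{n→n'} satisfying φ(V) := ∑_{y=1}^{n'} max_{x∈[n]} V(y|x) = n − 1, then every column of V either contains a unique row maximizer or has exactly one nonzero entry. Here an entry V(y|x) is a row maximizer if V(y|x) = max_{x'∈[n]} V(y|x'), and it is a unique row maximizer if in addition V(y|x) > V(y|x') for all x' ≠ x. -/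
open Finset

/-- An ambiguous guessing game matrix `G^{n,n'}_{k,d}`. -/
def IsAmbiguousGame (n n' k d : ℕ) (G : Matrix (Fin n') (Fin n) ℝ) : Prop :=
  ∃ S : Finset (Fin n'), S.card = k ∧
    (∀ y ∈ S, ∃ x₀, G y x₀ = 1 ∧ ∀ x, x ≠ x₀ → G y x = 0) ∧
    ∀ y ∉ S, ∀ x, G y x = 1 / ((n : ℝ) - (d : ℝ) + 1)

/-- The `(k,d)`-ambiguous polytope `A_{k,d}^{n → n'}`. -/
def ambiguousPolytope (n n' k d : ℕ) : Set (Matrix (Fin n') (Fin n) ℝ) :=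
  {P | IsChannel P ∧ ∀ G, IsAmbiguousGame n n' k d G → bip G P ≤ (d : ℝ)}

/-- A channel whose entries in column `x` are dominated by the sum of the other entries in
their row lies in every ambiguous polytope with `d = n - 1`. -/
lemma mem_ambiguousPolytope_of_le_sum_erase {n n' k : ℕ} (hn : 1 ≤ n)
    {P : Matrix (Fin n') (Fin n) ℝ} (hP : IsChannel P) (x : Fin n)
    (hx : ∀ y, P y x ≤ ∑ c ∈ univ.erase x, P y c) :
    P ∈ ambiguousPolytope n n' k (n - 1) := by
  refine ⟨hP, ?_⟩
  rintro G ⟨S, -, hS, hS'⟩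
  have row : ∀ y, ∑ c, G y c * P y c ≤ ∑ c ∈ univ.erase x, P y c := by
    intro y
    by_cases hy : y ∈ S
    · obtain ⟨x₀, h1, h0⟩ := hS y hy
      rw [Finset.sum_eq_single x₀ (fun c _ hc => by rw [h0 c hc, zero_mul]) (by simp), h1, one_mul]
      by_cases hxx : x₀ = x
      · exact hxx ▸ hx y
      · exact Finset.single_le_sum (f := fun c => P y c) (fun c _ => hP.1 y c) (by simp [hxx])
    · have h2 : ∀ c, G y c = 1 / 2 := fun c => by
        rw [hS' y hy c, Nat.cast_sub hn]; norm_num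
      simp only [h2]
      rw [← Finset.mul_sum, ← Finset.add_sum_erase univ (P y) (mem_univ x)]
      linarith [hx y]
  calc bip G P = ∑ y, ∑ c, G y c * P y c := Finset.sum_comm
    _ ≤ ∑ y, ∑ c ∈ univ.erase x, P y c := Finset.sum_le_sum fun y _ => row y
    _ = ∑ c ∈ univ.erase x, ∑ y, P y c := Finset.sum_comm
    _ = ((n - 1 : ℕ) : ℝ) := by simp [hP.2]

/-- If the column `x` of a channel is dominated, row by row, by the sum of the other columns,
then its mass can be distributed over the other columns. -/
lemma exists_split_of_le_sum_erase {n n' : ℕ} {P : Matrix (Fin n') (Fin n) ℝ}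
    (hP : IsChannel P) (x : Fin n) (hx : ∀ y, P y x ≤ ∑ c ∈ univ.erase x, P y c) :
    ∃ u : Fin n' → Fin n → ℝ, (∀ y c, 0 ≤ u y c) ∧ (∀ y c, u y c ≤ P y c) ∧
      ∀ y, ∑ c ∈ univ.erase x, u y c = P y x := by
  have hs : ∀ y, 0 ≤ ∑ c ∈ univ.erase x, P y c := fun y => Finset.sum_nonneg fun c _ => hP.1 y c
  refine ⟨fun y c => P y x / (∑ c ∈ univ.erase x, P y c) * P y c, fun y c => ?_, fun y c => ?_,
    fun y => ?_⟩
  · exact mul_nonneg (div_nonneg (hP.1 y x) (hs y)) (hP.1 y c)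
  · exact mul_le_of_le_one_left (hP.1 y c) (div_le_one_of_le₀ (hx y) (hs y))
  · rw [← Finset.mul_sum]
    rcases (hs y).eq_or_lt with h | h
    · have := hx y
      rw [← h] at this ⊢
      linarith [hP.1 y x]
    · exact div_mul_cancel₀ _ h.ne'

/-- A channel whose column `x` is dominated, row by row, by the sum of the other columns is a
proper mixture of such channels, one of which is deterministic in column `x`, with any prescribed
output `y₀` that is neither impossible nor certain. -/
lemma exists_mixture_of_le_sum_erase {n n' : ℕ} {P : Matrix (Fin n') (Fin n) ℝ}
    (hP : IsChannel P) (x : Fin n) (hx : ∀ y, P y x ≤ ∑ c ∈ univ.erase x, P y c)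
    (y₀ : Fin n') (h0 : 0 < P y₀ x) (h1 : P y₀ x < 1) :
    ∃ Q R : Matrix (Fin n') (Fin n) ℝ,
      (IsChannel Q ∧ ∀ y, Q y x ≤ ∑ c ∈ univ.erase x, Q y c) ∧
      (IsChannel R ∧ ∀ y, R y x ≤ ∑ c ∈ univ.erase x, R y c) ∧
      P ∈ openSegment ℝ Q R ∧ Q y₀ x = 1 := by
  obtain ⟨u, hu0, huP, hus⟩ := exists_split_of_le_sum_erase hP x hx
  obtain ⟨b, hb, hlpos⟩ : ∃ b ∈ univ.erase x, 0 < u y₀ b := by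
    by_contra! h
    have := Finset.sum_nonpos h
    rw [hus] at this
    linarith
  have hbx : b ≠ x := (Finset.mem_erase.1 hb).1
  set l := u y₀ b
  have hl1 : l < 1 := by
    have := Finset.single_le_sum (f := fun c => u y₀ c) (fun c _ => hu0 y₀ c) hb
    rw [hus] at this
    linarith
  have ht : ∀ c, c ≠ x → c ≠ b → l ≤ 1 - ∑ y, u y c := by
    intro c hcx hcb
    have htot : ∑ c ∈ univ.erase x, ∑ y, u y c = 1 := by
      rw [Finset.sum_comm]; simp only [hus, hP.2]
    have hpair : ∑ c ∈ ({c, b} : Finset (Fin n)), ∑ y, u y c ≤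
        ∑ c ∈ univ.erase x, ∑ y, u y c := by
      apply Finset.sum_le_sum_of_subset_of_nonneg
      · intro z hz
        simp only [mem_insert, mem_singleton] at hz
        rcases hz with rfl | rfl <;> simp [*]
      · exact fun z _ _ => Finset.sum_nonneg fun y _ => hu0 y z
    rw [Finset.sum_pair hcb, htot] at hpair
    have := Finset.single_le_sum (f := fun y => u y b) (fun y _ => hu0 y b) (mem_univ y₀)
    linarith
  let Q : Matrix (Fin n') (Fin n) ℝ := fun y c =>
    if c = x ∨ c = b then (if y = y₀ then 1 else 0) else (P y c - u y c) / (1 - ∑ y, u y c)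
  let R : Matrix (Fin n') (Fin n) ℝ := fun y c => (P y c - l * Q y c) / (1 - l)
  have hQ0 : ∀ y c, 0 ≤ Q y c := by
    intro y c
    simp only [Q]
    split_ifs with h
    · norm_num
    · norm_num
    · push Not at h
      exact div_nonneg (by linarith [huP y c]) (by linarith [ht c h.1 h.2])
  have hQ1 : ∀ c, ∑ y, Q y c = 1 := by
    intro c
    by_cases h : c = x ∨ c = b
    · simp [Q, h]
    · simp only [Q, if_neg h]
      push Not at h
      rw [← Finset.sum_div, Finset.sum_sub_distrib, hP.2]
      exact div_self (by linarith [ht c h.1 h.2])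
  have hQx : ∀ y, Q y x = if y = y₀ then 1 else 0 := fun y => by simp [Q]
  have hQb : ∀ y, Q y b = if y = y₀ then 1 else 0 := fun y => by simp [Q]
  have key : ∀ y c, c ≠ x →
      u y c - (if c = b then l * Q y x else 0) ≤ P y c - l * Q y c := by
    intro y c hc
    by_cases h : c = b
    · subst h
      rw [if_pos rfl, hQb, hQx]
      linarith [huP y c]
    · have hlt := ht c hc h
      have h3 : l * Q y c ≤ P y c - u y c := by
        simp only [Q, hc, h, or_self, if_false]
        rw [mul_div_assoc', div_le_iff₀ (by linarith), mul_comm]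
        exact mul_le_mul_of_nonneg_left hlt (by linarith [huP y c])
      rw [if_neg h]
      linarith
  have hlu : ∀ y, l * Q y x ≤ u y b := by
    intro y
    rw [hQx]
    split_ifs with h
    · rw [h, mul_one]
    · simpa using hu0 y b
  have hub : ∀ y, u y b ≤ P y x := fun y => by
    rw [← hus]
    exact Finset.single_le_sum (f := fun c => u y c) (fun c _ => hu0 y c) hb
  have hl' : 0 < 1 - l := by linarith
  refine ⟨Q, R, ⟨⟨hQ0, hQ1⟩, fun y => ?_⟩, ⟨⟨fun y c => ?_, fun c => ?_⟩, fun y => ?_⟩,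
    ⟨l, 1 - l, hlpos, hl', by ring, ?_⟩, by simp [hQx]⟩
  · rw [hQx, ← hQb]
    exact Finset.single_le_sum (f := fun c => Q y c) (fun c _ => hQ0 y c) hb
  · refine div_nonneg ?_ hl'.le
    by_cases hc : c = x
    · subst hc
      linarith [hlu y, hub y]
    · refine le_trans ?_ (key y c hc)
      split_ifs with h
      · subst h; linarith [hlu y]
      · simpa using hu0 y c
  · simp only [R]
    rw [← Finset.sum_div, Finset.sum_sub_distrib, ← Finset.mul_sum, hP.2, hQ1, mul_one,
      div_self hl'.ne']
  · simp only [R]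
    rw [← Finset.sum_div]
    refine div_le_div_of_nonneg_right ?_ hl'.le
    calc P y x - l * Q y x
        = ∑ c ∈ univ.erase x, (u y c - if c = b then l * Q y x else 0) := by
          rw [Finset.sum_sub_distrib, hus, Finset.sum_ite_eq' _ b, if_pos hb]
      _ ≤ _ := Finset.sum_le_sum fun c hc => key y c (Finset.mem_erase.1 hc).1
  · ext y c
    change l * Q y c + (1 - l) * ((P y c - l * Q y c) / (1 - l)) = P y c
    rw [mul_div_cancel₀ _ hl'.ne']
    ring

/-- Proposition (Appendix E, partial-ML): if `V` is an extreme point of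
`A_∩^{n→n'} = ⋂_{k=n}^{n'} A_{k,n-1}^{n→n'}` with `φ(V) = n - 1`, then every column
of `V` contains a unique row maximizer or has exactly one nonzero entry. -/
theorem partialML (n n' : ℕ) (hn : 2 ≤ n) (hnn' : n ≤ n')
    (V : Matrix (Fin n') (Fin n) ℝ)
    (hV : V ∈ Set.extremePoints ℝ
      (⋂ k ∈ Finset.Icc n n', ambiguousPolytope n n' k (n - 1)))
    (hφ : mlScore V = (n : ℝ) - 1) :
    ∀ x, (∃ y, ∀ x', x' ≠ x → V y x' < V y x) ∨ (∃! y, V y x ≠ 0) := by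
  intro x
  rw [or_iff_not_imp_left]
  intro hmax
  push Not at hmax
  rw [mem_extremePoints_iff_left] at hV
  obtain ⟨hVmem, hVext⟩ := hV
  have hch : IsChannel V := (Set.mem_iInter₂.1 hVmem n (by simp [hnn'])).1
  have hdom : ∀ y, V y x ≤ ∑ c ∈ univ.erase x, V y c := by
    intro y
    obtain ⟨x', hx', hle⟩ := hmax y
    exact hle.trans <| Finset.single_le_sum (f := fun c => V y c) (fun c _ => hch.1 y c)
      (by simp [hx'])
  have hmem : ∀ P : Matrix (Fin n') (Fin n) ℝ,
      (IsChannel P ∧ ∀ y, P y x ≤ ∑ c ∈ univ.erase x, P y c) →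
      P ∈ ⋂ k ∈ Finset.Icc n n', ambiguousPolytope n n' k (n - 1) := fun P hP =>
    Set.mem_iInter₂.2 fun k _ => mem_ambiguousPolytope_of_le_sum_erase (by omega) hP.1 x hP.2
  obtain ⟨y₀, -, hy₀⟩ : ∃ y ∈ univ, 0 < V y x := by
    by_contra! h
    linarith [Finset.sum_nonpos h, hch.2 x]
  have hle : V y₀ x ≤ 1 := by
    rw [← hch.2 x]
    exact Finset.single_le_sum (f := fun y => V y x) (fun y _ => hch.1 y x) (mem_univ y₀)
  have hone : V y₀ x = 1 := by
    by_contra hne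
    obtain ⟨Q, R, hQ, hR, hseg, hQ1⟩ :=
      exists_mixture_of_le_sum_erase hch x hdom y₀ hy₀ (lt_of_le_of_ne hle hne)
    rw [hVext Q (hmem Q hQ) R (hmem R hR) hseg] at hQ1
    exact hne hQ1
  refine ⟨y₀, hy₀.ne', fun y hy => ?_⟩
  by_contra hyne
  have hsum := hch.2 x
  rw [← Finset.add_sum_erase univ (fun y => V y x) (mem_univ y₀), hone] at hsum
  have hy_le := Finset.single_le_sum (f := fun y => V y x) (s := univ.erase y₀)
    (fun y _ => hch.1 y x) (mem_erase.2 ⟨hyne, mem_univ y⟩)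
  exact hy (le_antisymm (by linarith) (hch.1 y x))
end

section
/- Proposition (Appendix E, full-ML): Let n' ≥ n ≥ 2 be integers and let A_∩^{n→n'} := ⋂_{k=n}^{n'} A_{k,n−1}^{n→n'}. If V is an extreme point of A_∩^{n→n'} satisfying φ(V) := ∑_{y=1}^{n'} max_{x∈[n]} V(y|x) = n − 1, then V is an extreme point of the signaling polytope C_{n−1}^{n→n'}; that is, V is a column-stochastic matrix with 0/1 entries having at most n−1 nonzero rows. -/
open Finset

theorem convex_isChannel (n n' : ℕ) :
    Convex ℝ {P : Matrix (Fin n') (Fin n) ℝ | IsChannel P} := by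
  rintro P ⟨hP, hP'⟩ Q ⟨hQ, hQ'⟩ a b ha hb hab
  refine ⟨fun y x => ?_, fun x => ?_⟩
  · simp only [Matrix.add_apply, Matrix.smul_apply, smul_eq_mul]
    exact add_nonneg (mul_nonneg ha (hP y x)) (mul_nonneg hb (hQ y x))
  · simp only [Matrix.add_apply, Matrix.smul_apply, smul_eq_mul, sum_add_distrib, ← mul_sum,
      hP' x, hQ' x, mul_one, hab]

theorem bip_add_smul {n n' : ℕ} (G P Q : Matrix (Fin n') (Fin n) ℝ) (a b : ℝ) :
    bip G (a • P + b • Q) = a * bip G P + b * bip G Q := by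
  simp only [bip, Matrix.add_apply, Matrix.smul_apply, smul_eq_mul, mul_sum, ← sum_add_distrib]
  refine sum_congr rfl fun x _ => sum_congr rfl fun y _ => ?_
  ring

theorem convex_ambiguousPolytope (n n' k d : ℕ) : Convex ℝ (ambiguousPolytope n n' k d) := by
  rintro P ⟨hP, hPG⟩ Q ⟨hQ, hQG⟩ a b ha hb hab
  refine ⟨convex_isChannel n n' hP hQ ha hb hab, fun G hG => ?_⟩
  rw [bip_add_smul]
  calc a * bip G P + b * bip G Q ≤ a * d + b * d :=
        add_le_add (mul_le_mul_of_nonneg_left (hPG G hG) ha)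
          (mul_le_mul_of_nonneg_left (hQG G hG) hb)
    _ = d := by rw [← add_mul, hab, one_mul]

/-- A channel two of whose columns coincide. -/
def HasRepeatedColumn {n n' : ℕ} (P : Matrix (Fin n') (Fin n) ℝ) : Prop :=
  IsChannel P ∧ ∃ x₁ x₂, x₁ ≠ x₂ ∧ ∀ y, P y x₁ = P y x₂

theorem HasRepeatedColumn.mem_ambiguousPolytope {n n' : ℕ} (k : ℕ) (hn : 1 ≤ n)
    {P : Matrix (Fin n') (Fin n) ℝ} (hP : HasRepeatedColumn P) :
    P ∈ ambiguousPolytope n n' k (n - 1) := by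
  obtain ⟨hch, x₁, x₂, hne, heq⟩ := hP
  refine ⟨hch, ?_⟩
  rintro G ⟨S, -, hS, hS'⟩
  have hle : ∀ y, ∀ x ≠ x₁, P y x ≤ ∑ x ∈ univ.erase x₁, P y x := fun y x hx =>
    single_le_sum (f := fun x => P y x) (fun z _ => hch.1 y z) (by simp [hx])
  have hrow : ∀ y, ∑ x, G y x * P y x ≤ ∑ x ∈ univ.erase x₁, P y x := by
    intro y
    by_cases hy : y ∈ S
    · obtain ⟨x₀, h1, h0⟩ := hS y hy
      rw [sum_eq_single x₀ (fun x _ hx => by rw [h0 x hx, zero_mul]) (by simp), h1, one_mul]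
      by_cases hx : x₀ = x₁
      · rw [hx, heq]
        exact hle y x₂ hne.symm
      · exact hle y x₀ hx
    · have hG : ∀ x, G y x = 1 / 2 := fun x => by
        rw [hS' y hy x, Nat.cast_sub hn]
        norm_num
      simp only [hG, ← mul_sum]
      rw [← add_sum_erase univ _ (mem_univ x₁), heq y]
      linarith [hle y x₂ hne.symm]
  calc bip G P = ∑ y, ∑ x, G y x * P y x := sum_comm
    _ ≤ ∑ y, ∑ x ∈ univ.erase x₁, P y x := sum_le_sum fun y _ => hrow y
    _ = ∑ x ∈ univ.erase x₁, ∑ y, P y x := sum_comm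
    _ = ((n - 1 : ℕ) : ℝ) := by simp [hch.2]

/-- A channel whose row maxima sum to `n - 1`, and in each of whose rows the maximum dominates the
sum of the other entries, is a convex combination of channels with a repeated column. -/
theorem mem_convexHull_hasRepeatedColumn {n n' : ℕ} {V : Matrix (Fin n') (Fin n) ℝ}
    (hV : IsChannel V) (c : Fin n' → Fin n) (hsum : ∑ y, V y (c y) = (n : ℝ) - 1)
    (hdom : ∀ y, ∑ x, V y x ≤ 2 * V y (c y)) :
    V ∈ convexHull ℝ {P : Matrix (Fin n') (Fin n) ℝ | HasRepeatedColumn P} := by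
  set w : Fin n' × Fin n → ℝ := fun p => if p.2 = c p.1 then 0 else V p.1 p.2 with hw
  set s : Fin n' → ℝ := fun y => ∑ x, w (y, x) with hs
  set r : Fin n' → ℝ := fun y => V y (c y) - s y with hr
  set ρ : Fin n → ℝ := fun x => ∑ y, if c y = x then r y else 0 with hρ
  set q : Matrix (Fin n') (Fin n) ℝ := fun z x =>
    if ρ x = 0 then V z x else if c z = x then r z / ρ x else 0 with hq
  set W : Fin n' × Fin n → Matrix (Fin n') (Fin n) ℝ := fun p z x =>
    if x = p.2 ∨ x = c p.1 then (if z = p.1 then 1 else 0) else q z x with hW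
  have hw0 : ∀ p, 0 ≤ w p := fun p => by
    simp only [hw]
    split_ifs
    exacts [le_rfl, hV.1 _ _]
  have hs_add : ∀ y, s y + V y (c y) = ∑ x, V y x := fun y => by
    have : V y (c y) = ∑ x, if x = c y then V y x else 0 := by simp
    rw [this, hs, ← sum_add_distrib]
    refine sum_congr rfl fun x _ => ?_
    simp only [hw]
    split_ifs <;> simp
  have hr0 : ∀ y, 0 ≤ r y := fun y => by
    have := hdom y
    rw [← hs_add y] at this
    simp only [hr]
    linarith
  have hρ0 : ∀ x, 0 ≤ ρ x := fun x => sum_nonneg fun y _ => by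
    split_ifs
    exacts [hr0 y, le_rfl]
  have hq_ch : IsChannel q := by
    refine ⟨fun z x => ?_, fun x => ?_⟩
    · simp only [hq]
      split_ifs
      exacts [hV.1 z x, div_nonneg (hr0 z) (hρ0 x), le_rfl]
    · by_cases h : ρ x = 0
      · simp only [hq, h, if_true, hV.2 x]
      · have : ∀ z, q z x = (if c z = x then r z else 0) / ρ x := fun z => by
          simp only [hq, h, if_false]
          split_ifs <;> simp
        simp only [this, ← sum_div]
        exact div_self h
  have hw1 : ∑ p, w p = 1 := by
    have h1 : ∑ y, ∑ x, V y x = n := sum_comm.trans (by simp [hV.2])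
    simp only [← hs_add, sum_add_distrib, hsum] at h1
    rw [Fintype.sum_prod_type]
    linarith
  have hWmem : ∀ p, w p ≠ 0 → HasRepeatedColumn (W p) := by
    intro p hp
    have hne : p.2 ≠ c p.1 := fun h => hp (by simp [hw, h])
    refine ⟨⟨fun z x => ?_, fun x => ?_⟩, p.2, c p.1, hne, fun y => by simp [hW]⟩
    · simp only [hW]
      split_ifs
      exacts [zero_le_one, le_rfl, hq_ch.1 z x]
    · by_cases h : x = p.2 ∨ x = c p.1
      · simp [hW, h]
      · simp only [hW, h, if_false, hq_ch.2 x]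
  have hcol : ∀ x, ∑ p, w p * (if x = p.2 ∨ x = c p.1 then 0 else 1) = ρ x := by
    intro x
    have h1 : ∀ p : Fin n' × Fin n, w p * (if x = p.2 ∨ x = c p.1 then 0 else 1) =
        w p - (if x = p.2 then w p else 0) - (if x = c p.1 then w p else 0) := by
      intro p
      by_cases ha : x = p.2 <;> by_cases hb : x = c p.1
      · have : w p = 0 := by simp [hw, ← ha, ← hb]
        simp [this]
      · rw [if_pos (Or.inl ha), if_pos ha, if_neg hb]
        ring
      · rw [if_pos (Or.inr hb), if_neg ha, if_pos hb]
        ring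
      · simp [ha, hb]
    have h2 : ∑ p : Fin n' × Fin n, (if x = c p.1 then w p else 0) =
        ∑ y, if c y = x then s y else 0 := by
      rw [Fintype.sum_prod_type]
      refine sum_congr rfl fun y _ => ?_
      by_cases h : c y = x
      · simp [h, hs]
      · simp [h, Ne.symm h]
    have h3 : ∑ p : Fin n' × Fin n, (if x = p.2 then w p else 0) = ∑ y, w (y, x) := by
      rw [Fintype.sum_prod_type]
      simp
    have h4 : ∑ y, w (y, x) + ∑ y, (if c y = x then V y (c y) else 0) = 1 := by
      rw [← hV.2 x, ← sum_add_distrib]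
      refine sum_congr rfl fun y _ => ?_
      by_cases h : c y = x
      · simp [hw, h]
      · simp [hw, h, Ne.symm h]
    have h5 : ρ x = ∑ y, (if c y = x then V y (c y) else 0) -
        ∑ y, (if c y = x then s y else 0) := by
      rw [hρ, ← sum_sub_distrib]
      refine sum_congr rfl fun y _ => ?_
      simp only [hr]
      split_ifs <;> simp
    simp only [h1, sum_sub_distrib, h2, h3, hw1, h5]
    linarith
  have hmul : ∀ z x, ρ x * q z x = if c z = x then r z else 0 := by
    intro z x
    by_cases h : ρ x = 0
    · have := (sum_eq_zero_iff_of_nonneg (fun y _ => by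
        split_ifs
        exacts [hr0 y, le_rfl])).1 h z (mem_univ z)
      rw [h, zero_mul, this]
    · simp only [hq, h, if_false]
      split_ifs
      exacts [mul_div_cancel₀ _ h, mul_zero _]
  have hVW : V = ∑ p, w p • W p := by
    ext z x
    have h1 : ∀ p : Fin n' × Fin n, w p * W p z x =
        (if p.1 = z then (if x = p.2 ∨ x = c p.1 then w p else 0) else 0) +
          w p * (if x = p.2 ∨ x = c p.1 then 0 else 1) * q z x := by
      intro p
      by_cases ha : x = p.2 ∨ x = c p.1
      · by_cases hb : z = p.1
        · simp [hW, ha, hb]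
        · simp [hW, ha, hb, Ne.symm hb]
      · simp [hW, ha]
    have h2 : ∑ p : Fin n' × Fin n,
        (if p.1 = z then (if x = p.2 ∨ x = c p.1 then w p else 0) else 0) =
          if c z = x then s z else V z x := by
      rw [Fintype.sum_prod_type, sum_eq_single z (fun y _ hy => by simp [hy]) (by simp)]
      by_cases h : c z = x
      · simp [h, hs]
      · simp [h, Ne.symm h, hw]
    rw [Matrix.sum_apply]
    simp only [Matrix.smul_apply, smul_eq_mul, h1, sum_add_distrib, ← sum_mul, h2, hcol, hmul]
    by_cases h : c z = x
    · simp [h, hr]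
    · simp [h]
  have hsupp : ∑ p with w p ≠ 0, w p = 1 := by rw [sum_filter_ne_zero, hw1]
  have hVW' : V = ∑ p with w p ≠ 0, w p • W p := by
    rw [sum_filter_of_ne]
    · exact hVW
    · intro p _ hp h0
      simp [h0] at hp
  rw [hVW']
  exact (convex_convexHull ℝ _).sum_mem (fun p _ => hw0 p) hsupp fun p hp =>
    subset_convexHull ℝ _ (hWmem p (mem_filter.1 hp).2)

/-- When a channel is square, domination of each row by twice its maximum is automatic from the
maximum likelihood score. -/
theorem IsChannel.row_sum_le_of_square {n : ℕ} {V : Matrix (Fin n) (Fin n) ℝ}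
    (hV : IsChannel V) (c : Fin n → Fin n) (hc : ∀ y x, V y x ≤ V y (c y))
    (hsum : ∑ y, V y (c y) = (n : ℝ) - 1) (y : Fin n) :
    ∑ x, V y x ≤ 2 * V y (c y) := by
  set t : Fin n → ℝ := fun x => 1 - ∑ z, (if c z = x then V z x else 0) with ht
  have ht' : ∀ x, t x = ∑ z, (if c z = x then 0 else V z x) := fun x => by
    simp only [ht]
    rw [← hV.2 x, ← sum_sub_distrib]
    refine sum_congr rfl fun z _ => ?_
    split_ifs <;> simp
  have ht0 : ∀ x, 0 ≤ t x := fun x => by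
    rw [ht' x]
    refine sum_nonneg fun z _ => ?_
    split_ifs
    exacts [le_rfl, hV.1 z x]
  have hVt : ∀ x ≠ c y, V y x ≤ t x := fun x hx => by
    rw [ht' x]
    refine le_trans (by simp [Ne.symm hx])
      (single_le_sum (f := fun z => if c z = x then 0 else V z x) (fun z _ => ?_) (mem_univ y))
    split_ifs
    exacts [le_rfl, hV.1 z x]
  have htsum : ∑ x, t x = 1 := by
    simp only [ht, sum_sub_distrib]
    rw [sum_comm]
    simp [hsum]
  rw [← add_sum_erase univ _ (mem_univ (c y))]
  suffices ∑ x ∈ univ.erase (c y), V y x ≤ V y (c y) by linarith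
  by_cases hinj : Function.Injective c
  · have h1 : t (c y) = 1 - V y (c y) := by
      simp [ht, hinj.eq_iff]
    rw [← add_sum_erase univ _ (mem_univ (c y)), h1] at htsum
    have : ∑ x ∈ univ.erase (c y), V y x ≤ ∑ x ∈ univ.erase (c y), t x :=
      sum_le_sum fun x hx => hVt x (ne_of_mem_erase hx)
    linarith
  · have hsurj : ¬ Function.Surjective c := fun h => hinj (Finite.injective_iff_surjective.2 h)
    simp only [Function.Surjective, not_forall, not_exists] at hsurj
    obtain ⟨x', hx'⟩ := hsurj
    have h1 : t x' = 1 := by simp [ht, hx']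
    rw [← add_sum_erase univ _ (mem_univ x'), h1] at htsum
    have hzero : ∀ x ≠ x', t x = 0 := fun x hx =>
      (sum_eq_zero_iff_of_nonneg fun x _ => ht0 x).1 (by linarith) x (by simp [hx])
    refine le_trans (le_of_eq (sum_eq_single x' (fun x hx hne => ?_) fun h => ?_)) (hc y x')
    · exact le_antisymm (hzero x hne ▸ hVt x (ne_of_mem_erase hx)) (hV.1 y x)
    · exact (h (by simp [Ne.symm (hx' y)])).elim

/-- If leaving a single row ambiguous is allowed, then the maximum likelihood constraint being tight
forces each row sum to be at most twice the row maximum. -/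
theorem row_sum_le_of_mem_ambiguousPolytope {n n' : ℕ} (hn : 1 ≤ n)
    {V : Matrix (Fin n') (Fin n) ℝ} (hV : V ∈ ambiguousPolytope n n' (n' - 1) (n - 1))
    (c : Fin n' → Fin n) (hsum : ∑ y, V y (c y) = (n : ℝ) - 1) (y : Fin n') :
    ∑ x, V y x ≤ 2 * V y (c y) := by
  let G : Matrix (Fin n') (Fin n) ℝ := fun z x =>
    if z = y then 1 / 2 else if x = c z then 1 else 0
  have hG : IsAmbiguousGame n n' (n' - 1) (n - 1) G := by
    refine ⟨univ.erase y, by simp, fun z hz => ⟨c z, ?_, fun x hx => ?_⟩, fun z hz x => ?_⟩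
    · simp [G, ne_of_mem_erase hz]
    · simp [G, ne_of_mem_erase hz, hx]
    · have : z = y := by simpa using hz
      simp only [G, this, if_true, Nat.cast_sub hn]
      norm_num
  have h := hV.2 G hG
  have h1 : bip G V = 1 / 2 * ∑ x, V y x + ∑ z ∈ univ.erase y, V z (c z) := by
    rw [bip, sum_comm, ← add_sum_erase univ _ (mem_univ y)]
    congr 1
    · simp [G, mul_sum]
    · refine sum_congr rfl fun z hz => ?_
      simp [G, ne_of_mem_erase hz]
  rw [h1, Nat.cast_sub hn] at h
  rw [← add_sum_erase univ _ (mem_univ y)] at hsum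
  push_cast at h
  linarith

/-- Moving mass `η` from row `y'` to row `y` in all columns equal to column `x` preserves channels
with a repeated column. -/
theorem HasRepeatedColumn.add_shift {n n' : ℕ} {V : Matrix (Fin n') (Fin n) ℝ}
    (hV : HasRepeatedColumn V) {y y' : Fin n'} (hy : y ≠ y') (x : Fin n) {η : ℝ}
    (h1 : -V y x ≤ η) (h2 : η ≤ V y' x) (D : Matrix (Fin n') (Fin n) ℝ)
    (hD : ∀ u v, D u v = if V.col v = V.col x then
      (Pi.single y η : Fin n' → ℝ) u - (Pi.single y' η : Fin n' → ℝ) u else 0) :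
    HasRepeatedColumn (V + D) := by
  obtain ⟨hch, x₁, x₂, hne, heq⟩ := hV
  refine ⟨⟨fun z v => ?_, fun v => ?_⟩, x₁, x₂, hne, fun z => ?_⟩
  · rw [Matrix.add_apply, hD]
    split_ifs with h
    · have hz : V z v = V z x := congrFun h z
      rw [hz]
      by_cases hzy : z = y
      · subst hzy
        simp only [Pi.single_eq_same, Pi.single_eq_of_ne hy]
        linarith
      · by_cases hzy' : z = y'
        · subst hzy'
          simp only [Pi.single_eq_same, Pi.single_eq_of_ne hzy]
          linarith
        · simpa [hzy, hzy'] using hch.1 z x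
    · simpa using hch.1 z v
  · simp only [Matrix.add_apply, hD, sum_add_distrib, hch.2]
    split_ifs <;> simp
  · have : V.col x₁ = V.col x₂ := funext heq
    rw [Matrix.add_apply, Matrix.add_apply, hD, hD, heq, this]

theorem HasRepeatedColumn.eq_zero_or_one {n n' : ℕ} {V : Matrix (Fin n') (Fin n) ℝ}
    (hV : V ∈ Set.extremePoints ℝ {P : Matrix (Fin n') (Fin n) ℝ | HasRepeatedColumn P})
    (y : Fin n') (x : Fin n) : V y x = 0 ∨ V y x = 1 := by
  by_contra! hcon
  have hch : IsChannel V := hV.1.1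
  have hpos : 0 < V y x := lt_of_le_of_ne (hch.1 y x) hcon.1.symm
  obtain ⟨y', hy', hpos'⟩ : ∃ y', y ≠ y' ∧ 0 < V y' x := by
    by_contra! h
    apply hcon.2
    rw [← hch.2 x]
    exact (sum_eq_single y (fun z _ hz => le_antisymm (h z hz.symm) (hch.1 z x)) (by simp)).symm
  set ε := min (V y x) (V y' x)
  have hε0 : 0 < ε := lt_min hpos hpos'
  have hεy : ε ≤ V y x := min_le_left _ _
  have hεy' : ε ≤ V y' x := min_le_right _ _
  obtain ⟨D, hD⟩ : ∃ D : Matrix (Fin n') (Fin n) ℝ, ∀ u v, D u v = if V.col v = V.col x then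
      (Pi.single y ε : Fin n' → ℝ) u - (Pi.single y' ε : Fin n' → ℝ) u else 0 :=
    ⟨fun u v => _, fun _ _ => rfl⟩
  have hp : HasRepeatedColumn (V + D) :=
    HasRepeatedColumn.add_shift hV.1 hy' x (by linarith) hεy' D hD
  have hm : HasRepeatedColumn (V + -D) := by
    refine HasRepeatedColumn.add_shift (η := -ε) hV.1 hy' x (by linarith) (by linarith) (-D)
      fun u v => ?_
    simp only [Matrix.neg_apply, hD, Pi.single_neg, Pi.neg_apply]
    split_ifs <;> ring
  have hseg : V ∈ openSegment ℝ (V + D) (V + -D) :=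
    ⟨1 / 2, 1 / 2, by norm_num, by norm_num, by norm_num, by module⟩
  have h := congrFun (congrFun (hV.2 hp hm hseg) y) x
  simp only [Matrix.add_apply, hD, if_true, Pi.single_eq_same, Pi.single_eq_of_ne hy'] at h
  linarith

theorem HasRepeatedColumn.isVertex {n n' : ℕ} {V : Matrix (Fin n') (Fin n) ℝ}
    (hV : HasRepeatedColumn V) (h01 : ∀ y x, V y x = 0 ∨ V y x = 1) : IsVertex (n - 1) V := by
  obtain ⟨hch, x₁, x₂, hne, heq⟩ := hV
  refine ⟨hch, h01, ?_⟩
  have huniq : ∀ x, ∃ y, ∀ z, V z x ≠ 0 → z = y := by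
    intro x
    obtain ⟨y, -, hy⟩ : ∃ y ∈ univ, V y x ≠ 0 := exists_ne_zero_of_sum_ne_zero (by simp [hch.2 x])
    refine ⟨y, fun z hz => ?_⟩
    by_contra hzy
    have h : ∑ u ∈ {z, y}, V u x ≤ ∑ u, V u x :=
      sum_le_sum_of_subset_of_nonneg (subset_univ _) fun u _ _ => hch.1 u x
    rw [sum_pair hzy, hch.2, (h01 z x).resolve_left hz, (h01 y x).resolve_left hy] at h
    norm_num at h
  choose f hf using huniq
  have hsub : {y : Fin n' | ∃ x, V y x ≠ 0} ⊆ ((univ.erase x₁).image f : Finset (Fin n')) := by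
    rintro y ⟨x, hx⟩
    simp only [coe_image, Set.mem_image, mem_coe, mem_erase, mem_univ, and_true]
    by_cases h : x = x₁
    · subst h
      exact ⟨x₂, hne.symm, (hf x₂ y (heq y ▸ hx)).symm⟩
    · exact ⟨x, h, (hf x y hx).symm⟩
  calc _ ≤ ((univ.erase x₁).image f : Set (Fin n')).ncard := Set.ncard_le_ncard hsub
    _ ≤ n - 1 := by
      rw [Set.ncard_coe_finset]
      exact card_image_le.trans (by simp)

theorem IsVertex.mem_extremePoints {n n' d : ℕ} {V : Matrix (Fin n') (Fin n) ℝ}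
    (hV : IsVertex d V) : V ∈ Set.extremePoints ℝ (signalingPolytope n n' d) := by
  have hsub : signalingPolytope n n' d ⊆ {P | IsChannel P} :=
    convexHull_min (fun P hP => hP.1) (convex_isChannel n n')
  refine ⟨subset_convexHull ℝ _ hV, ?_⟩
  rintro P hP Q hQ ⟨a, b, ha, hb, hab, rfl⟩
  have hPc : IsChannel P := hsub hP
  have hQc : IsChannel Q := hsub hQ
  ext y x
  have h := hV.2.1 y x
  simp only [Matrix.add_apply, Matrix.smul_apply, smul_eq_mul] at h ⊢
  have hP0 := hPc.1 y x
  have hQ0 := hQc.1 y x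
  have hP1 := hPc.le_one y x
  have hQ1 := hQc.le_one y x
  rcases h with h | h
  · have : a * P y x = 0 := by nlinarith [mul_nonneg ha.le hP0, mul_nonneg hb.le hQ0]
    rw [h]
    exact (mul_eq_zero.1 this).resolve_left ha.ne'
  · have : a * (1 - P y x) = 0 := by
      nlinarith [mul_nonneg ha.le (sub_nonneg.2 hP1), mul_nonneg hb.le (sub_nonneg.2 hQ1)]
    rw [h]
    linarith [(mul_eq_zero.1 this).resolve_left (ne_of_gt ha)]

/-- Proposition (Appendix E, full-ML): if `V` is an extreme point of
`A_∩^{n→n'} = ⋂_{k=n}^{n'} A_{k,n-1}^{n→n'}` with `φ(V) = n - 1`, then `V` is an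
extreme point of `C_{n-1}^{n→n'}`, i.e. a column-stochastic 0/1 matrix with at
most `n - 1` nonzero rows. -/
theorem fullML (n n' : ℕ) (hn : 2 ≤ n) (hnn' : n ≤ n')
    (V : Matrix (Fin n') (Fin n) ℝ)
    (hV : V ∈ Set.extremePoints ℝ
      (⋂ k ∈ Finset.Icc n n', ambiguousPolytope n n' k (n - 1)))
    (hφ : mlScore V = (n : ℝ) - 1) :
    V ∈ Set.extremePoints ℝ (signalingPolytope n n' (n - 1)) ∧
      IsVertex (n - 1) V := by
  have hn1 : 1 ≤ n := by omega
  have : Nonempty (Fin n) := ⟨⟨0, by omega⟩⟩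
  have hmem : ∀ k, n ≤ k → k ≤ n' → V ∈ ambiguousPolytope n n' k (n - 1) := fun k h1 h2 =>
    Set.mem_iInter₂.1 hV.1 k (mem_Icc.2 ⟨h1, h2⟩)
  have hch : IsChannel V := (hmem n le_rfl hnn').1
  choose c hc using fun y => Finite.exists_max (V y)
  have hsum : ∑ y, V y (c y) = (n : ℝ) - 1 := by
    rw [← hφ, mlScore]
    exact sum_congr rfl fun y _ =>
      le_antisymm (le_ciSup (Set.finite_range (V y)).bddAbove (c y)) (ciSup_le (hc y))
  have hdom : ∀ y, ∑ x, V y x ≤ 2 * V y (c y) := by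
    rcases hnn'.eq_or_lt with rfl | hlt
    · exact hch.row_sum_le_of_square c hc hsum
    · exact row_sum_le_of_mem_ambiguousPolytope hn1 (hmem (n' - 1) (by omega) (by omega)) c hsum
  have hsub : {P : Matrix (Fin n') (Fin n) ℝ | HasRepeatedColumn P} ⊆
      ⋂ k ∈ Finset.Icc n n', ambiguousPolytope n n' k (n - 1) := fun P hP =>
    Set.mem_iInter₂.2 fun k _ => HasRepeatedColumn.mem_ambiguousPolytope k hn1 hP
  have hconv : Convex ℝ (⋂ k ∈ Finset.Icc n n', ambiguousPolytope n n' k (n - 1)) :=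
    convex_iInter₂ fun k _ => convex_ambiguousPolytope n n' k (n - 1)
  have hrep : V ∈ {P : Matrix (Fin n') (Fin n) ℝ | HasRepeatedColumn P} :=
    extremePoints_convexHull_subset
    (inter_extremePoints_subset_extremePoints_of_subset (convexHull_min hsub hconv)
      ⟨mem_convexHull_hasRepeatedColumn hch c hsum hdom, hV⟩)
  have hvert : IsVertex (n - 1) V := HasRepeatedColumn.isVertex hrep
    (HasRepeatedColumn.eq_zero_or_one
      (inter_extremePoints_subset_extremePoints_of_subset hsub ⟨hrep, hV⟩))
  exact ⟨hvert.mem_extremePoints, hvert⟩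
end

section
/- Lemma (Appendix F, six-column lemma): For every positive integer n there exist a positive integer s and pairs (G_1,γ_1), …, (G_s,γ_s) with each G_m ∈ ℝ^{4×n} having at most six nonzero columns and γ_m ∈ ℝ, such that C_2^{n→4} = ⋂_{m=1}^{s} {P ∈ P^{n→4} : ⟨G_m,P⟩ ≤ γ_m}. -/
open Finset

lemma exists_forall_add_mul_nonpos_iff {ι : Type*} [Finite ι] (a c : ι → ℝ) :
    (∃ v : ℝ, ∀ i, a i + c i * v ≤ 0) ↔
      (∀ i, c i = 0 → a i ≤ 0) ∧
        ∀ i j, 0 < c i → c j < 0 → c i * a j - c j * a i ≤ 0 := by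
  constructor
  · rintro ⟨v, hv⟩
    refine ⟨fun i hi => by simpa [hi] using hv i, fun i j hi hj => ?_⟩
    nlinarith [mul_le_mul_of_nonneg_left (hv j) hi.le,
      mul_le_mul_of_nonneg_left (hv i) (neg_nonneg.2 hj.le)]
  · rintro ⟨h0, hpq⟩
    obtain ⟨v, hlo, hup⟩ : ∃ v : ℝ, (∀ i, c i < 0 → -a i / c i ≤ v) ∧
        ∀ i, 0 < c i → v ≤ -a i / c i := by
      by_cases hn : ∃ i, c i < 0
      · obtain ⟨i, hi, hmax⟩ := Set.exists_max_image {i | c i < 0} (fun i => -a i / c i)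
          (Set.toFinite _) hn
        refine ⟨-a i / c i, hmax, fun j hj => ?_⟩
        rw [le_div_iff₀ hj, div_mul_eq_mul_div, div_le_iff_of_neg hi]
        linarith [hpq j i hj hi]
      · obtain ⟨v, hv⟩ := (Set.finite_range fun i => -a i / c i).bddBelow
        exact ⟨v, fun i hi => (hn ⟨i, hi⟩).elim, fun i _ => hv ⟨i, rfl⟩⟩
    refine ⟨v, fun i => ?_⟩
    rcases lt_trichotomy (c i) 0 with hi | hi | hi
    · have := hlo i hi
      rw [div_le_iff_of_neg hi] at this
      linarith
    · simpa [hi] using h0 i hi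
    · have := hup i hi
      rw [le_div_iff₀ hi] at this
      linarith

/-- Fourier–Motzkin elimination of finitely many variables. -/
lemma exists_finite_forall_nonpos_iff {V : Type*} (M : Submodule ℝ (V → ℝ)) (k : ℕ) :
    ∀ {ι : Type} [Finite ι] (a : ι → V → ℝ) (b : ι → Fin k → ℝ), (∀ i, a i ∈ M) →
      ∃ T : Set (V → ℝ), T.Finite ∧ T ⊆ M ∧
        ∀ p, (∃ u : Fin k → ℝ, ∀ i, a i p + ∑ j, b i j * u j ≤ 0) ↔ ∀ f ∈ T, f p ≤ 0 := by
  induction k with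
  | zero =>
    intro ι _ a b ha
    refine ⟨Set.range a, Set.finite_range a, Set.range_subset_iff.2 ha, fun p => ?_⟩
    simp
  | succ k ih =>
    intro ι _ a b ha
    obtain ⟨T, hT, hTM, h⟩ := ih
      (ι := {i // b i 0 = 0} ⊕ {q : ι × ι // 0 < b q.1 0 ∧ b q.2 0 < 0})
      (Sum.elim (fun i => a i)
        fun q => b q.1.1 0 • a q.1.2 - b q.1.2 0 • a q.1.1)
      (Sum.elim (fun i j => b i j.succ)
        fun q j => b q.1.1 0 * b q.1.2 j.succ - b q.1.2 0 * b q.1.1 j.succ)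
      (by
        rintro (i | q)
        · exact ha i
        · exact M.sub_mem (M.smul_mem _ (ha _)) (M.smul_mem _ (ha _)))
    refine ⟨T, hT, hTM, fun p => ?_⟩
    rw [← h p]
    have key (u : Fin k → ℝ) :
        (∃ v : ℝ, ∀ i, a i p + ∑ j, b i j * (Fin.cons v u : Fin (k + 1) → ℝ) j ≤ 0) ↔
          ∀ i, Sum.elim (fun i : {i // b i 0 = 0} => a i)
            (fun q : {q : ι × ι // 0 < b q.1 0 ∧ b q.2 0 < 0} =>
              b q.1.1 0 • a q.1.2 - b q.1.2 0 • a q.1.1) i p +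
            ∑ j, Sum.elim (fun (i : {i // b i 0 = 0}) j => b i (Fin.succ j))
              (fun (q : {q : ι × ι // 0 < b q.1 0 ∧ b q.2 0 < 0}) j =>
                b q.1.1 0 * b q.1.2 (Fin.succ j) - b q.1.2 0 * b q.1.1 (Fin.succ j)) i j * u j
              ≤ 0 := by
      have := exists_forall_add_mul_nonpos_iff
        (fun i => a i p + ∑ j, b i (Fin.succ j) * u j) fun i => b i 0
      simp only [Fin.sum_univ_succ, Fin.cons_zero, Fin.cons_succ]
      convert this using 5
      · ring
      · simp only [Sum.forall, Subtype.forall, Prod.forall, Sum.elim_inl, Sum.elim_inr,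
          and_imp, Pi.sub_apply, Pi.smul_apply, smul_eq_mul, sub_mul, mul_assoc,
          Finset.sum_sub_distrib, ← Finset.mul_sum]
        refine and_congr Iff.rfl ?_
        refine forall₄_congr fun i j _ _ => ?_
        rw [show ∀ s t x y z w : ℝ, s * x - t * y + (s * z - t * w) =
          s * (x + z) - t * (y + w) by intros; ring]
    refine Iff.trans ⟨?_, ?_⟩ (exists_congr key)
    · rintro ⟨u, hu⟩
      exact ⟨Fin.tail u, u 0, by simpa using hu⟩
    · rintro ⟨u, v, hu⟩
      exact ⟨Fin.cons v u, hu⟩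

/-- `A` is cut out by finitely many inequalities `f p ≤ 0` with `f ∈ M`. -/
def IsPolyhedral {V : Type*} (M : Submodule ℝ (V → ℝ)) (A : Set V) : Prop :=
  ∃ T : Set (V → ℝ), T.Finite ∧ T ⊆ M ∧ ∀ p, p ∈ A ↔ ∀ f ∈ T, f p ≤ 0

namespace IsPolyhedral

variable {V : Type*} {M : Submodule ℝ (V → ℝ)}

lemma setOf_nonpos {f : V → ℝ} (hf : f ∈ M) : IsPolyhedral M {p | f p ≤ 0} :=
  ⟨{f}, Set.finite_singleton f, by simpa using hf, by simp⟩

lemma setOf_forall {ι : Sort*} [Finite ι] {A : ι → V → Prop}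
    (h : ∀ i, IsPolyhedral M {p | A i p}) : IsPolyhedral M {p | ∀ i, A i p} := by
  choose T hT hM h using h
  refine ⟨⋃ i, T i, Set.finite_iUnion hT, Set.iUnion_subset hM, fun p => ?_⟩
  simp only [Set.mem_ofPred_eq] at h ⊢
  simp only [h, Set.mem_iUnion, forall_exists_index]
  exact ⟨fun H f i => H i f, fun H i f => H f i⟩

lemma setOf_and {A B : V → Prop} (hA : IsPolyhedral M {p | A p})
    (hB : IsPolyhedral M {p | B p}) : IsPolyhedral M {p | A p ∧ B p} := by
  have := setOf_forall (ι := Bool) (A := fun i p => bif i then A p else B p)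
    (M := M) (by simpa using ⟨hB, hA⟩)
  simpa [and_comm] using this

lemma setOf_le {f g : V → ℝ} (hf : f ∈ M) (hg : g ∈ M) : IsPolyhedral M {p | f p ≤ g p} := by
  simpa using setOf_nonpos (M.sub_mem hf hg)

lemma setOf_eq {f g : V → ℝ} (hf : f ∈ M) (hg : g ∈ M) : IsPolyhedral M {p | f p = g p} := by
  simpa [le_antisymm_iff] using setOf_and (setOf_le hf hg) (setOf_le hg hf)

/-- Projecting away finitely many real variables preserves polyhedrality. -/
lemma image_fst {κ : Type*} [Finite κ] {N : Submodule ℝ (V × (κ → ℝ) → ℝ)}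
    (hN : ∀ f ∈ N, ∃ a ∈ M, ∃ b : (κ → ℝ) →ₗ[ℝ] ℝ, f = fun q => a q.1 + b q.2)
    {A : Set (V × (κ → ℝ))} (hA : IsPolyhedral N A) :
    IsPolyhedral M {p | ∃ u, (p, u) ∈ A} := by
  classical
  obtain ⟨T, hT, hTN, h⟩ := hA
  choose! a ha b hb using hN
  obtain ⟨k, ⟨e⟩⟩ := Finite.exists_equiv_fin κ
  have := Fintype.ofFinite κ
  obtain ⟨l, g, hg⟩ := hT.fin_param
  obtain rfl : T = Set.range g := hg.2.symm
  obtain ⟨T', hT', hT'M, h'⟩ := exists_finite_forall_nonpos_iff M k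
    (fun i => a (g i)) (fun i j => b (g i) (Pi.single (e.symm j) 1))
    fun i => ha _ (hTN ⟨i, rfl⟩)
  refine ⟨T', hT', hT'M, fun p => ?_⟩
  rw [← h' p]
  refine (e.arrowCongr (Equiv.refl ℝ)).exists_congr fun u => ?_
  rw [h, Set.forall_mem_range]
  refine forall_congr' fun i => ?_
  rw [congrFun (hb (g i) (hTN ⟨i, rfl⟩)) (p, u), LinearMap.pi_apply_eq_sum_univ (b (g i)) u,
    ← e.symm.sum_comp]
  have hsingle (x : κ) : (Pi.single x 1 : κ → ℝ) = fun j => if x = j then 1 else 0 := by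
    ext j
    simp [Pi.single_apply, eq_comm]
  simp [hsingle, mul_comm]

end IsPolyhedral

/-- Weightings `w` of the supports `r e` that are compatible with column `x` of `P`: that column
splits into pieces of mass `w e` supported on `r e`. -/
def columnWeights {n n' m : ℕ} (r : Fin m → Finset (Fin n')) (P : Matrix (Fin n') (Fin n) ℝ)
    (x : Fin n) : Set (Fin m → ℝ) :=
  {w | w ∈ stdSimplex ℝ (Fin m) ∧ ∃ t : Fin m → Fin n' → ℝ, (∀ e y, 0 ≤ t e y) ∧
    (∀ e, ∀ y ∉ r e, t e y = 0) ∧ (∀ e, ∑ y, t e y = w e) ∧ ∀ y, ∑ e, t e y = P y x}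

section columnWeights

variable {n n' m : ℕ} {r : Fin m → Finset (Fin n')}

lemma add_mem_columnWeights {P Q : Matrix (Fin n') (Fin n) ℝ} {x : Fin n} {v w : Fin m → ℝ}
    (hv : v ∈ columnWeights r P x) (hw : w ∈ columnWeights r Q x) {a b : ℝ} (ha : 0 ≤ a)
    (hb : 0 ≤ b) (hab : a + b = 1) : a • v + b • w ∈ columnWeights r (a • P + b • Q) x := by
  obtain ⟨hv, s, hs0, hsr, hsv, hsP⟩ := hv
  obtain ⟨hw, t, ht0, htr, htw, htQ⟩ := hw
  refine ⟨convex_stdSimplex ℝ _ hv hw ha hb hab, a • s + b • t, fun e y => ?_, fun e y hy => ?_,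
    fun e => ?_, fun y => ?_⟩
  · have := hs0 e y
    have := ht0 e y
    simp only [Pi.add_apply, Pi.smul_apply, smul_eq_mul]
    positivity
  · simp [hsr e y hy, htr e y hy]
  · simp [Finset.sum_add_distrib, ← Finset.mul_sum, hsv, htw]
  · simp [Finset.sum_add_distrib, ← Finset.mul_sum, hsP, htQ]

lemma convex_columnWeights (P : Matrix (Fin n') (Fin n) ℝ) (x : Fin n) :
    Convex ℝ (columnWeights r P x) := by
  intro v hv w hw a b ha hb hab
  simpa [← add_smul, hab] using add_mem_columnWeights hv hw ha hb hab

lemma convex_setOf_isChannel : Convex ℝ {P : Matrix (Fin n') (Fin n) ℝ | IsChannel P} := by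
  rintro P ⟨hP, hP'⟩ Q ⟨hQ, hQ'⟩ a b ha hb hab
  refine ⟨fun y x => ?_, fun x => ?_⟩
  · have := hP y x
    have := hQ y x
    simp only [Matrix.add_apply, Matrix.smul_apply, smul_eq_mul]
    positivity
  · simp [Finset.sum_add_distrib, ← Finset.mul_sum, hP', hQ', hab]

lemma isChannel_of_mem_signalingPolytope {d : ℕ} {P : Matrix (Fin n') (Fin n) ℝ}
    (hP : P ∈ signalingPolytope n n' d) : IsChannel P :=
  convexHull_min (fun _ hV => hV.1) convex_setOf_isChannel hP

lemma exists_mem_columnWeights {d : ℕ}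
    (hr : ∀ s : Finset (Fin n'), s.card ≤ d → ∃ e, s ⊆ r e) {P : Matrix (Fin n') (Fin n) ℝ}
    (hP : P ∈ signalingPolytope n n' d) : ∃ w, ∀ x, w ∈ columnWeights r P x := by
  classical
  refine convexHull_min (t := {P | ∃ w, ∀ x, w ∈ columnWeights r P x}) ?_ ?_ hP
  · rintro V ⟨hV, -, hd⟩
    obtain ⟨e, he⟩ := hr (Finset.univ.filter fun y => ∃ x, V y x ≠ 0)
      (by rw [← Set.ncard_coe_finset]; simpa using hd)
    refine ⟨Pi.single e 1, fun x => ⟨single_mem_stdSimplex ℝ e, fun e' y => if e' = e then V y x else 0,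
      fun e' y => ?_, fun e' y hy => ?_, fun e' => ?_, fun y => ?_⟩⟩
    · dsimp only
      split_ifs
      exacts [hV.1 y x, le_rfl]
    · dsimp only
      split_ifs with h
      · subst h
        by_contra hne
        exact hy (he (by simpa using ⟨x, hne⟩))
      · rfl
    · by_cases h : e' = e
      · subst h; simp [hV.2 x]
      · simp [h]
    · simp
  · rintro P ⟨v, hv⟩ Q ⟨w, hw⟩ a b ha hb hab
    exact ⟨_, fun x => add_mem_columnWeights (hv x) (hw x) ha hb hab⟩

/-- Channels supported on a set of at most `d` rows are mixtures of vertices. -/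
lemma mem_signalingPolytope_of_support {d : ℕ} {s : Finset (Fin n')} (hs : s.card ≤ d)
    {P : Matrix (Fin n') (Fin n) ℝ} (hP : IsChannel P) (h : ∀ y ∉ s, ∀ x, P y x = 0) :
    P ∈ signalingPolytope n n' d := by
  classical
  have hcol (x : Fin n) : (fun y => P y x) ∈
      convexHull ℝ ((fun y => (Pi.single y 1 : Fin n' → ℝ)) '' (s : Set (Fin n'))) := by
    have hsum : ∑ y ∈ s, P y x = 1 := by
      rw [← hP.2 x]
      exact Finset.sum_subset (Finset.subset_univ s) fun y _ hy => h y hy x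
    have := (convex_convexHull ℝ _).sum_mem (fun y _ => hP.1 y x) hsum
      (fun y hy => subset_convexHull ℝ _ (Set.mem_image_of_mem
        (fun y => (Pi.single y 1 : Fin n' → ℝ)) (Finset.mem_coe.2 hy)))
    convert this with y
    by_cases hy : y ∈ s
    · simp [Finset.sum_apply, Pi.single_apply, hy]
    · simp [Finset.sum_apply, Pi.single_apply, hy, h y hy x]
  have hpi : P.transpose ∈ convexHull ℝ (Set.univ.pi fun _ : Fin n =>
      (fun y => (Pi.single y 1 : Fin n' → ℝ)) '' (s : Set (Fin n'))) := by
    rw [convexHull_pi]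
    exact fun x _ => hcol x
  have := Set.mem_image_of_mem (Matrix.transposeLinearEquiv (Fin n) (Fin n') ℝ ℝ).toLinearMap hpi
  erw [LinearMap.image_convexHull] at this
  refine convexHull_mono ?_ this
  rintro _ ⟨V, hV, rfl⟩
  choose f hf hfV using fun x => hV x (Set.mem_univ x)
  have hV' (y x) : V x y = if y = f x then 1 else 0 := by
    simp [← hfV x, Pi.single_apply]
  refine ⟨⟨fun y x => ?_, fun x => ?_⟩, fun y x => ?_, ?_⟩
  · change 0 ≤ V x y
    rw [hV']
    positivity
  · simp [hV']
  · simp [hV', em']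
  · refine (Set.ncard_le_ncard (t := s) ?_).trans (by simpa using hs)
    rintro y ⟨x, hx⟩
    simp [hV'] at hx
    exact hx ▸ hf x

lemma mem_signalingPolytope_of_mem_columnWeights {d : ℕ} (hrd : ∀ e, (r e).card ≤ d)
    (hne : ∀ e, (r e).Nonempty) {P : Matrix (Fin n') (Fin n) ℝ} {w : Fin m → ℝ}
    (hw1 : w ∈ stdSimplex ℝ (Fin m)) (hw : ∀ x, w ∈ columnWeights r P x) :
    P ∈ signalingPolytope n n' d := by
  classical
  choose t ht0 htr htw htP using fun x => (hw x).2
  choose c hc using hne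
  let R (e : Fin m) : Matrix (Fin n') (Fin n) ℝ := fun y x =>
    if w e = 0 then (if y = c e then 1 else 0) else t x e y / w e
  have hR (e) : R e ∈ signalingPolytope n n' d := by
    refine mem_signalingPolytope_of_support (hrd e) ⟨fun y x => ?_, fun x => ?_⟩ fun y hy x => ?_
    · have := ht0 x e y
      have := hw1.1 e
      simp only [R]
      positivity
    · by_cases h : w e = 0
      · simp [R, h]
      · simp [R, h, ← Finset.sum_div, htw]
    · have : y ≠ c e := fun h => hy (h ▸ hc e)
      simp [R, this, htr x e y hy]
  have : P = ∑ e, w e • R e := by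
    ext y x
    rw [← htP x y, Matrix.sum_apply]
    refine Finset.sum_congr rfl fun e _ => ?_
    by_cases h : w e = 0
    · have := (Finset.sum_eq_zero_iff_of_nonneg fun y _ => ht0 x e y).1 ((htw x e).trans h)
      simp [h, this y]
    · rw [Matrix.smul_apply]
      simp [R, h, mul_div_cancel₀]
  rw [this]
  exact (convex_convexHull ℝ _).sum_mem (fun e _ => hw1.1 e) hw1.2 fun e _ => hR e

/-- Helly's theorem for convex sets in a hyperplane. -/
lemma exists_forall_mem_of_subset_stdSimplex {ι : Type*} [Fintype ι] {k : ℕ}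
    {K : ι → Set (Fin (k + 1) → ℝ)} (hK : ∀ i, Convex ℝ (K i))
    (hs : ∀ i, K i ⊆ stdSimplex ℝ (Fin (k + 1)))
    (h : ∀ I : Finset ι, I.card ≤ k + 1 → ∃ w ∈ stdSimplex ℝ (Fin (k + 1)), ∀ i ∈ I, w ∈ K i) :
    ∃ w ∈ stdSimplex ℝ (Fin (k + 1)), ∀ i, w ∈ K i := by
  let π := LinearMap.funLeft ℝ ℝ (Fin.succ : Fin k → Fin (k + 1))
  cases isEmpty_or_nonempty ι with
  | inl _ =>
    obtain ⟨w, hw, -⟩ := h ∅ (by simp)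
    exact ⟨w, hw, isEmptyElim⟩
  | inr hι =>
    obtain ⟨u, hu⟩ := Convex.helly_theorem' (𝕜 := ℝ) (F := fun i => π '' K i) (s := Finset.univ)
      (fun i _ => (hK i).linear_image π) fun I _ hI => by
        obtain ⟨w, -, hw⟩ := h I (by simpa using hI)
        exact ⟨π w, Set.mem_iInter₂.2 fun i hi => ⟨w, hw i hi, rfl⟩⟩
    simp only [Finset.mem_univ, Set.iInter_true, Set.mem_iInter] at hu
    choose w hw hwu using hu
    obtain ⟨i₀⟩ := hι
    refine ⟨w i₀, hs _ (hw i₀), fun i => ?_⟩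
    suffices h_eq : w i₀ = w i from h_eq ▸ hw i
    have htail (j : Fin k) : w i₀ j.succ = w i j.succ := congrFun ((hwu i₀).trans (hwu i).symm) j
    have h₁ := (hs _ (hw i₀)).2
    have h₂ := (hs _ (hw i)).2
    rw [Fin.sum_univ_succ] at h₁ h₂
    simp only [htail] at h₁
    funext j
    refine Fin.cases (by linarith) htail j

end columnWeights

/-- Affine functionals of a matrix that only depend on the columns in `S`. -/
def columnFunctionals {n : ℕ} (n' : ℕ) (S : Finset (Fin n)) :
    Submodule ℝ (Matrix (Fin n') (Fin n) ℝ → ℝ) :=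
  Submodule.span ℝ ({fun _ => 1} ∪ {f | ∃ y, ∃ x ∈ S, f = fun P => P y x})

section columnFunctionals

variable {n n' m : ℕ} {S : Finset (Fin n)}

lemma one_mem_columnFunctionals : (fun _ => 1) ∈ columnFunctionals n' S :=
  Submodule.subset_span (.inl rfl)

lemma entry_mem_columnFunctionals (y : Fin n') {x : Fin n} (hx : x ∈ S) :
    (fun P => P y x) ∈ columnFunctionals n' S :=
  Submodule.subset_span (.inr ⟨y, x, hx, rfl⟩)

lemma exists_bip_of_mem_columnFunctionals {f : Matrix (Fin n') (Fin n) ℝ → ℝ}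
    (hf : f ∈ columnFunctionals n' S) :
    ∃ (G : Matrix (Fin n') (Fin n) ℝ) (γ : ℝ), (∀ y, ∀ x ∉ S, G y x = 0) ∧
      ∀ P, f P = bip G P - γ := by
  classical
  induction hf using Submodule.span_induction with
  | mem f hf =>
    rcases hf with rfl | ⟨y, x, hx, rfl⟩
    · exact ⟨0, -1, by simp, by simp [bip]⟩
    · refine ⟨fun y' x' => if x' = x then (if y' = y then 1 else 0) else 0, 0,
        fun y' x' hx' => if_neg (ne_of_mem_of_not_mem hx hx').symm, fun P => ?_⟩
      simp [bip]
  | zero => exact ⟨0, 0, by simp, by simp [bip]⟩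
  | add f g _ _ hf hg =>
    obtain ⟨G, γ, hG, hf⟩ := hf
    obtain ⟨H, δ, hH, hg⟩ := hg
    refine ⟨G + H, γ + δ, fun y x hx => by simp [hG y x hx, hH y x hx], fun P => ?_⟩
    simp only [Pi.add_apply, hf, hg, bip, Matrix.add_apply, add_mul, Finset.sum_add_distrib]
    ring
  | smul c f _ hf =>
    obtain ⟨G, γ, hG, hf⟩ := hf
    refine ⟨c • G, c * γ, fun y x hx => by simp [hG y x hx], fun P => ?_⟩
    simp only [Pi.smul_apply, hf, bip, Matrix.smul_apply, smul_eq_mul, mul_assoc,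
      ← Finset.mul_sum]
    ring

/-- The compatibility of finitely many columns with a common weighting is described by finitely
many linear inequalities in the entries of these columns. -/
lemma isPolyhedral_setOf_exists_columnWeights (r : Fin m → Finset (Fin n')) :
    IsPolyhedral (columnFunctionals n' S) {P : Matrix (Fin n') (Fin n) ℝ |
      ∃ w ∈ stdSimplex ℝ (Fin m), ∀ x ∈ S, w ∈ columnWeights r P x} := by
  classical
  let κ := Fin m ⊕ Fin n × Fin m × Fin n'
  let N : Submodule ℝ (Matrix (Fin n') (Fin n) ℝ × (κ → ℝ) → ℝ) :=
    Submodule.span ℝ ({fun _ => 1} ∪ {f | ∃ y, ∃ x ∈ S, f = fun q => q.1 y x} ∪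
      {f | ∃ k, f = fun q => q.2 k})
  have hone : (fun _ => 1) ∈ N := Submodule.subset_span (.inl (.inl rfl))
  have hentry (y) (x : S) : (fun q => q.1 y x) ∈ N :=
    Submodule.subset_span (.inl (.inr ⟨y, x, x.2, rfl⟩))
  have hcoord (k) : (fun q => q.2 k) ∈ N := Submodule.subset_span (.inr ⟨k, rfl⟩)
  have hsum {α : Type} [Fintype α] (k : α → κ) : (fun q => ∑ i, q.2 (k i)) ∈ N := by
    have := N.sum_mem (t := Finset.univ) fun i _ => hcoord (k i)
    convert this
    simp
  have hzero : (fun _ => 0) ∈ N := N.zero_mem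
  have hN : ∀ f ∈ N, ∃ a ∈ columnFunctionals n' S, ∃ b : (κ → ℝ) →ₗ[ℝ] ℝ,
      f = fun q => a q.1 + b q.2 := by
    intro f hf
    induction hf using Submodule.span_induction with
    | mem f hf =>
      rcases hf with (rfl | ⟨y, x, hx, rfl⟩) | ⟨k, rfl⟩
      · exact ⟨_, one_mem_columnFunctionals, 0, by simp⟩
      · exact ⟨_, entry_mem_columnFunctionals y hx, 0, by simp⟩
      · exact ⟨0, zero_mem _, LinearMap.proj k, by simp⟩
    | zero => exact ⟨0, zero_mem _, 0, by ext; simp⟩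
    | add f g _ _ hf hg =>
      obtain ⟨a, ha, b, rfl⟩ := hf
      obtain ⟨a', ha', b', rfl⟩ := hg
      exact ⟨a + a', add_mem ha ha', b + b', by ext; simp; ring⟩
    | smul c f _ hf =>
      obtain ⟨a, ha, b, rfl⟩ := hf
      exact ⟨c • a, Submodule.smul_mem _ c ha, c • b, by ext; simp; ring⟩
  have hsystem : IsPolyhedral N {q : Matrix (Fin n') (Fin n) ℝ × (κ → ℝ) |
      ((∀ e, 0 ≤ q.2 (.inl e)) ∧ ∑ e, q.2 (.inl e) = 1) ∧
        ∀ x : S, (∀ e y, 0 ≤ q.2 (.inr (x, e, y))) ∧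
          (∀ e, ∀ y : {y // y ∉ r e}, q.2 (.inr (x, e, y)) = 0) ∧
          (∀ e, ∑ y, q.2 (.inr (x, e, y)) = q.2 (.inl e)) ∧
          ∀ y, ∑ e, q.2 (.inr (x, e, y)) = q.1 y x} := by
    refine .setOf_and (.setOf_and (.setOf_forall fun e => ?_) ?_) (.setOf_forall fun x =>
      .setOf_and (.setOf_forall fun e => .setOf_forall fun y => ?_) (.setOf_and
        (.setOf_forall fun e => .setOf_forall fun y => ?_) (.setOf_and
          (.setOf_forall fun e => ?_) (.setOf_forall fun y => ?_))))
    · exact .setOf_le hzero (hcoord _)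
    · exact .setOf_eq (hsum _) hone
    · exact .setOf_le hzero (hcoord _)
    · exact .setOf_eq (hcoord _) hzero
    · exact .setOf_eq (hsum _) (hcoord _)
    · exact .setOf_eq (hsum _) (hentry y x)
  convert IsPolyhedral.image_fst hN hsystem using 1
  ext P
  constructor
  · rintro ⟨w, hw, h⟩
    choose! t ht using fun x hx => (h x hx).2
    refine ⟨Sum.elim w fun q => t q.1 q.2.1 q.2.2, hw, fun x => ?_⟩
    obtain ⟨h0, hr, hw, hP⟩ := ht x x.2
    exact ⟨h0, fun e y => hr e y y.2, hw, hP⟩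
  · rintro ⟨u, hw, h⟩
    refine ⟨fun e => u (.inl e), hw, fun x hx => ⟨hw, fun e y => u (.inr (x, e, y)), ?_⟩⟩
    obtain ⟨h0, hr, hw, hP⟩ := h ⟨x, hx⟩
    exact ⟨h0, fun e y hy => hr e ⟨y, hy⟩, hw, hP⟩

end columnFunctionals

/-- If `k + 1` sets of rows of size at most `d` suffice to contain every set of at most `d` rows,
then membership in the signaling polytope can be tested on `k + 1` columns at a time. -/
lemma mem_signalingPolytope_iff {n n' d k : ℕ} {r : Fin (k + 1) → Finset (Fin n')}
    (hr : ∀ s : Finset (Fin n'), s.card ≤ d → ∃ e, s ⊆ r e) (hrd : ∀ e, (r e).card ≤ d)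
    (hne : ∀ e, (r e).Nonempty) {P : Matrix (Fin n') (Fin n) ℝ} :
    P ∈ signalingPolytope n n' d ↔ ∀ S : Finset (Fin n), S.card ≤ k + 1 →
      ∃ w ∈ stdSimplex ℝ (Fin (k + 1)), ∀ x ∈ S, w ∈ columnWeights r P x := by
  constructor
  · intro h S _
    obtain ⟨w, hw⟩ := exists_mem_columnWeights hr h
    obtain rfl | ⟨x, hx⟩ := S.eq_empty_or_nonempty
    · exact ⟨Pi.single 0 1, single_mem_stdSimplex ℝ 0, by simp⟩
    · exact ⟨w, (hw x).1, fun x _ => hw x⟩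
  · intro h
    obtain ⟨w, hw, hwx⟩ := exists_forall_mem_of_subset_stdSimplex
      (fun x => convex_columnWeights (r := r) P x) (fun _ _ hw => hw.1) h
    exact mem_signalingPolytope_of_mem_columnWeights hrd hne hw hwx

/-- Six-column lemma (Appendix F): for every `n`, the signaling polytope
`C_2^{n → 4}` is the intersection of finitely many Bell-inequality half-spaces
whose matrices each have at most six nonzero columns. -/
theorem six_column_lemma (n : ℕ) (hn : 0 < n) :
    ∃ (s : ℕ), 0 < s ∧
      ∃ (G : Fin s → Matrix (Fin 4) (Fin n) ℝ) (γ : Fin s → ℝ),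
        (∀ m, ({j : Fin n | ∃ y, G m y j ≠ 0}).ncard ≤ 6) ∧
        signalingPolytope n 4 2 =
          ⋂ m, {P : Matrix (Fin 4) (Fin n) ℝ | IsChannel P ∧ bip (G m) P ≤ γ m} := by
  classical
  let r : Fin 6 → Finset (Fin 4) := ![{0, 1}, {0, 2}, {0, 3}, {1, 2}, {1, 3}, {2, 3}]
  have hr : ∀ s : Finset (Fin 4), s.card ≤ 2 → ∃ e, s ⊆ r e := by decide
  have hrd : ∀ e, (r e).card ≤ 2 := by decide
  have hne : ∀ e, (r e).Nonempty := by decide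
  choose T hT hTM hTP using fun S : Finset (Fin n) =>
    isPolyhedral_setOf_exists_columnWeights (S := S) r
  have hfin : (insert 0 (⋃ S : {S : Finset (Fin n) // S.card ≤ 6}, T S)).Finite :=
    (Set.finite_iUnion fun S => hT _).insert 0
  obtain ⟨s, f, -, hf⟩ := hfin.fin_param
  have hbip (i : Fin s) : ∃ (G : Matrix (Fin 4) (Fin n) ℝ) (γ : ℝ),
      ({j : Fin n | ∃ y, G y j ≠ 0}).ncard ≤ 6 ∧ ∀ P, f i P = bip G P - γ := by
    have hi : f i ∈ Set.range f := ⟨i, rfl⟩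
    obtain ⟨S, hS, hfS⟩ : ∃ S : Finset (Fin n), S.card ≤ 6 ∧ f i ∈ columnFunctionals 4 S := by
      rw [hf] at hi
      rcases hi with h0 | hi
      · exact ⟨∅, by simp, h0 ▸ zero_mem _⟩
      · obtain ⟨S, hS⟩ := Set.mem_iUnion.1 hi
        exact ⟨S, S.2, hTM _ hS⟩
    obtain ⟨G, γ, hG, hfG⟩ := exists_bip_of_mem_columnFunctionals hfS
    refine ⟨G, γ, (Set.ncard_le_ncard (t := S) ?_).trans (by simpa using hS), hfG⟩
    rintro x ⟨y, hy⟩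
    by_contra hx
    exact hy (hG y x hx)
  choose G γ hG hfG using hbip
  have hs : 0 < s := by
    obtain ⟨i, -⟩ : (0 : Matrix (Fin 4) (Fin n) ℝ → ℝ) ∈ Set.range f := hf ▸ Set.mem_insert _ _
    exact i.pos
  have hiff (P : Matrix (Fin 4) (Fin n) ℝ) : (∀ i, bip (G i) P ≤ γ i) ↔
      ∀ S : Finset (Fin n), S.card ≤ 6 →
        ∃ w ∈ stdSimplex ℝ (Fin 6), ∀ x ∈ S, w ∈ columnWeights r P x := by
    have h (S) := hTP S P
    simp only [Set.mem_ofPred_eq] at h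
    simp only [← sub_nonpos (b := γ _), ← hfG, h]
    rw [← Set.forall_mem_range (f := f)
      (p := fun g : Matrix (Fin 4) (Fin n) ℝ → ℝ => g P ≤ 0), hf]
    simp only [Set.mem_insert_iff, Set.mem_iUnion, Subtype.exists, forall_eq_or_imp]
    constructor
    · exact fun H S hS g hg => H.2 g ⟨S, hS, hg⟩
    · rintro H
      exact ⟨le_rfl, fun g ⟨S, hS, hg⟩ => H S hS g hg⟩
  refine ⟨s, hs, G, γ, hG, ?_⟩
  ext P
  simp only [Set.mem_iInter, Set.mem_ofPred_eq]
  constructor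
  · intro hP
    have hch := isChannel_of_mem_signalingPolytope hP
    exact fun i => ⟨hch, (hiff P).2 ((mem_signalingPolytope_iff hr hrd hne).1 hP) i⟩
  · intro hP
    exact (mem_signalingPolytope_iff hr hrd hne).2 ((hiff P).1 fun i => (hP i).2)
end

section
/- Proposition (Appendix G, maximum likelihood bound for replacer channels): Let d ≥ 1 and D ≥ d be integers, let σ be a D×D density matrix, let 0 ≤ μ ≤ 1, and let R_μ be the partial replacer channel with target σ. Then for every positive integers n, n', every collection of states {ρ_x}_{x∈[n]} on ℂ^d, and every POVM {Π_y}_{y∈[n']} on ℂ^D, the induced classical channel P satisfies ∑_{y=1}^{n'} max_{x∈[n]} P(y|x) ≤ μd + (1 − μ), where P(y|x) = Tr[Π_y R_μ(ρ_x)]. -/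
open Finset

open scoped ComplexOrder

/-- A density matrix: positive semidefinite with unit trace. -/
def IsDensity {D : ℕ} (ρ : Matrix (Fin D) (Fin D) ℂ) : Prop :=
  ρ.PosSemidef ∧ ρ.trace = 1

/-- A POVM: positive semidefinite effects summing to the identity. -/
def IsPOVM {D n' : ℕ} (M : Fin n' → Matrix (Fin D) (Fin D) ℂ) : Prop :=
  (∀ y, (M y).PosSemidef) ∧ ∑ y, M y = 1

/-- Embed a `d × d` matrix as the upper-left block of a `D × D` matrix. -/
def embedBlock (d D : ℕ) (X : Matrix (Fin d) (Fin d) ℂ) :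
    Matrix (Fin D) (Fin D) ℂ :=
  Matrix.of fun i j =>
    if h : (i : ℕ) < d ∧ (j : ℕ) < d then X ⟨i, h.1⟩ ⟨j, h.2⟩ else 0

/-- The `d`-dimensional partial replacer channel with replacement state `σ`:
`R_μ(X) = μ·ι(X) + (1-μ)·Tr[X]·σ`. -/
noncomputable def replacer (d D : ℕ) (μ : ℝ) (σ : Matrix (Fin D) (Fin D) ℂ)
    (X : Matrix (Fin d) (Fin d) ℂ) : Matrix (Fin D) (Fin D) ℂ :=
  (μ : ℂ) • embedBlock d D X + ((1 - μ : ℝ) : ℂ) • (X.trace • σ)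

/-- The classical channel induced by states `ρ`, the partial replacer channel,
and POVM `M`: `P(y|x) = Tr[M_y R_μ(ρ_x)]`. -/
noncomputable def inducedChannel (d D n n' : ℕ) (μ : ℝ)
    (σ : Matrix (Fin D) (Fin D) ℂ) (ρ : Fin n → Matrix (Fin d) (Fin d) ℂ)
    (M : Fin n' → Matrix (Fin D) (Fin D) ℂ) : Matrix (Fin n') (Fin n) ℝ :=
  Matrix.of fun y x => ((M y * replacer d D μ σ (ρ x)).trace).re

/-- The partial replacer channel can be simulated with `d'` classical messages and
shared randomness: every induced classical channel lies in `C_{d'}^{n → n'}`. -/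
noncomputable def SimulableBy (d D : ℕ) (μ : ℝ)
    (σ : Matrix (Fin D) (Fin D) ℂ) (d' : ℕ) : Prop :=
  ∀ (n n' : ℕ), 0 < n → 0 < n' →
    ∀ (ρ : Fin n → Matrix (Fin d) (Fin d) ℂ)
      (M : Fin n' → Matrix (Fin D) (Fin D) ℂ),
      (∀ x, IsDensity (ρ x)) → IsPOVM M →
      inducedChannel d D n n' μ σ ρ M ∈ signalingPolytope n n' d'

section frobenius

open scoped Matrix MatrixOrder
open Matrix

attribute [local instance] Matrix.frobeniusNormedAddCommGroup

theorem re_trace_conjTranspose_mul_self {m n : Type*} [Fintype m] [Fintype n]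
    (A : Matrix m n ℂ) : (Aᴴ * A).trace.re = ‖A‖ ^ 2 := by
  have hnn : 0 ≤ ∑ i, ∑ j, ‖A i j‖ ^ 2 := by positivity
  have hnorm : ‖A‖ ^ 2 = ∑ i, ∑ j, ‖A i j‖ ^ 2 := by
    simp only [frobenius_norm_def, Real.rpow_two, ← Real.sqrt_eq_rpow]
    exact Real.sq_sqrt hnn
  rw [hnorm, Finset.sum_comm]
  simp only [trace, diag_apply, mul_apply, conjTranspose_apply, Complex.re_sum]
  refine Finset.sum_congr rfl fun j _ => Finset.sum_congr rfl fun i _ => ?_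
  rw [Complex.sq_norm, Complex.normSq_apply]
  simp

/-- The trace of a product of positive semidefinite matrices is at most the product of the
traces. -/
theorem Matrix.PosSemidef.re_trace_mul_le {m : Type*} [Fintype m]
    {A B : Matrix m m ℂ} (hA : A.PosSemidef) (hB : B.PosSemidef) :
    (A * B).trace.re ≤ A.trace.re * B.trace.re := by
  classical
  obtain ⟨S, rfl⟩ := CStarAlgebra.nonneg_iff_eq_star_mul_self.mp hA.nonneg
  obtain ⟨T, rfl⟩ := CStarAlgebra.nonneg_iff_eq_star_mul_self.mp hB.nonneg
  simp only [star_eq_conjTranspose]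
  have hcycle : (Sᴴ * S * (Tᴴ * T)).trace = ((S * Tᴴ)ᴴ * (S * Tᴴ)).trace := by
    rw [← Matrix.mul_assoc, trace_mul_comm, conjTranspose_mul, conjTranspose_conjTranspose]
    simp only [Matrix.mul_assoc]
  rw [hcycle, re_trace_conjTranspose_mul_self, re_trace_conjTranspose_mul_self,
    re_trace_conjTranspose_mul_self, ← mul_pow]
  gcongr
  exact (frobenius_norm_mul S Tᴴ).trans_eq (by rw [frobenius_norm_conjTranspose])

end frobenius

theorem trace_mul_embedBlock {d D : ℕ} (hdD : d ≤ D) (A : Matrix (Fin D) (Fin D) ℂ)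
    (X : Matrix (Fin d) (Fin d) ℂ) :
    (A * embedBlock d D X).trace =
      (A.submatrix (Fin.castLE hdD) (Fin.castLE hdD) * X).trace := by
  have hinj := Fin.castLE_injective hdD
  have hmem : ∀ i : Fin D, i ∉ Set.range (Fin.castLE hdD) → ¬ (i : ℕ) < d :=
    fun i hi h => hi ⟨⟨i, h⟩, rfl⟩
  simp only [Matrix.trace, Matrix.diag_apply, Matrix.mul_apply]
  symm
  refine Fintype.sum_of_injective _ hinj _ _ (fun i hi => ?_) fun i => ?_
  · exact Finset.sum_eq_zero fun j _ => by simp [embedBlock, hmem i hi]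
  · refine Fintype.sum_of_injective _ hinj _ _ (fun j hj => ?_) fun j => ?_
    · simp [embedBlock, hmem j hj]
    · simp [embedBlock]

theorem inducedChannel_apply_le {d D n n' : ℕ} (hdD : d ≤ D)
    {σ : Matrix (Fin D) (Fin D) ℂ} {μ : ℝ} (hμ0 : 0 ≤ μ)
    {ρ : Fin n → Matrix (Fin d) (Fin d) ℂ} {M : Fin n' → Matrix (Fin D) (Fin D) ℂ}
    {x : Fin n} {y : Fin n'} (hρ : IsDensity (ρ x)) (hM : (M y).PosSemidef) :
    inducedChannel d D n n' μ σ ρ M y x ≤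
      μ * ((M y).submatrix (Fin.castLE hdD) (Fin.castLE hdD)).trace.re +
        (1 - μ) * (M y * σ).trace.re := by
  have h := (hM.submatrix (Fin.castLE hdD)).re_trace_mul_le hρ.1
  rw [hρ.2, Complex.one_re, mul_one] at h
  simp only [inducedChannel, replacer, Matrix.of_apply, hρ.2, Matrix.mul_add,
    Matrix.mul_smul, Matrix.trace_add, Matrix.trace_smul, smul_eq_mul, one_mul, Complex.add_re,
    Complex.re_ofReal_mul, trace_mul_embedBlock hdD]
  gcongr

/-- Proposition (Appendix G): maximum likelihood bound for partial replacer
channels: `∑_y max_x P(y|x) ≤ μ d + (1 - μ)` for every induced classical channel. -/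
theorem replacer_ml_bound (d D : ℕ) (hd : 1 ≤ d) (hdD : d ≤ D)
    (σ : Matrix (Fin D) (Fin D) ℂ) (hσ : IsDensity σ)
    (μ : ℝ) (hμ0 : 0 ≤ μ) (hμ1 : μ ≤ 1)
    (n n' : ℕ) (hn : 0 < n) (hn' : 0 < n')
    (ρ : Fin n → Matrix (Fin d) (Fin d) ℂ)
    (M : Fin n' → Matrix (Fin D) (Fin D) ℂ)
    (hρ : ∀ x, IsDensity (ρ x)) (hM : IsPOVM M) :
    ∑ y : Fin n', ⨆ x, inducedChannel d D n n' μ σ ρ M y x ≤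
      μ * (d : ℝ) + (1 - μ) := by
  have : Nonempty (Fin n) := ⟨⟨0, hn⟩⟩
  have hblock : ∑ y, ((M y).submatrix (Fin.castLE hdD) (Fin.castLE hdD)).trace.re = d := by
    have h : ∑ y, (M y).submatrix (Fin.castLE hdD) (Fin.castLE hdD) = 1 := by
      rw [← Matrix.submatrix_one _ (Fin.castLE_injective hdD), ← hM.2]
      ext i j
      simp [Matrix.sum_apply]
    rw [← Complex.re_sum, ← Matrix.trace_sum, h]
    simp
  have hσM : ∑ y, (M y * σ).trace.re = 1 := by
    rw [← Complex.re_sum, ← Matrix.trace_sum, ← Finset.sum_mul, hM.2, one_mul, hσ.2,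
      Complex.one_re]
  calc ∑ y : Fin n', ⨆ x, inducedChannel d D n n' μ σ ρ M y x
      ≤ ∑ y, (μ * ((M y).submatrix (Fin.castLE hdD) (Fin.castLE hdD)).trace.re +
          (1 - μ) * (M y * σ).trace.re) :=
        Finset.sum_le_sum fun y _ => ciSup_le fun x =>
          inducedChannel_apply_le hdD hμ0 (hρ x) (hM.1 y)
    _ = μ * (d : ℝ) + (1 - μ) := by
        rw [Finset.sum_add_distrib, ← Finset.mul_sum, ← Finset.mul_sum, hblock, hσM, mul_one]
end
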